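/- arXiv:1302.2316 — 2 statements merged into one kernel-verified Lean document; each statement's English description precedes it below -/
import Mathlib

section
/- Let θ be an involution of the lattice S = E₈(2). Then the pair of fixed and anti-fixed sublattices (S₊(1/2), S₋(1/2)) is isomorphic to one of the ten pairs: (E₈, 0), (E₇, A₁), (D₆, A₁²), (D₄⊕A₁, A₁³), (D₄, D₄), (A₁⁴, A₁⁴), (A₁³, D₄⊕A₁), (A₁², D₆), (A₁, E₇), (0, E₈). -/
open Matrix

/-- Gram matrix of the negative definite root lattice `E₈`. -/
def E8G : Matrix (Fin 8) (Fin 8) ℤ :=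
  !![-2,  1,  0,  0,  0,  0,  0,  0;
      1, -2,  1,  0,  0,  0,  0,  0;
      0,  1, -2,  1,  0,  0,  0,  0;
      0,  0,  1, -2,  1,  0,  0,  0;
      0,  0,  0,  1, -2,  1,  0,  1;
      0,  0,  0,  0,  1, -2,  1,  0;
      0,  0,  0,  0,  0,  1, -2,  0;
      0,  0,  0,  0,  1,  0,  0, -2]

/-- Gram matrix of the negative definite root lattice `E₇`. -/
def E7G : Matrix (Fin 7) (Fin 7) ℤ :=
  !![-2,  1,  0,  0,  0,  0,  0;
      1, -2,  1,  0,  0,  0,  0;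
      0,  1, -2,  1,  0,  0,  0;
      0,  0,  1, -2,  1,  0,  1;
      0,  0,  0,  1, -2,  1,  0;
      0,  0,  0,  0,  1, -2,  0;
      0,  0,  0,  1,  0,  0, -2]

/-- Gram matrix of the negative definite root lattice `D₆`. -/
def D6G : Matrix (Fin 6) (Fin 6) ℤ :=
  !![-2,  1,  0,  0,  0,  0;
      1, -2,  1,  0,  0,  0;
      0,  1, -2,  1,  0,  0;
      0,  0,  1, -2,  1,  1;
      0,  0,  0,  1, -2,  0;
      0,  0,  0,  1,  0, -2]

/-- Gram matrix of the negative definite root lattice `D₄`. -/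
def D4G : Matrix (Fin 4) (Fin 4) ℤ :=
  !![-2,  1,  1,  1;
      1, -2,  0,  0;
      1,  0, -2,  0;
      1,  0,  0, -2]

/-- Gram matrix of the negative definite root lattice `D₄ ⊕ A₁`. -/
def D4A1G : Matrix (Fin 5) (Fin 5) ℤ :=
  !![-2,  1,  1,  1,  0;
      1, -2,  0,  0,  0;
      1,  0, -2,  0,  0;
      1,  0,  0, -2,  0;
      0,  0,  0,  0, -2]

/-- Gram matrix of the negative definite root lattice `A₁^k`. -/
def A1pow (k : ℕ) : Matrix (Fin k) (Fin k) ℤ :=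
  Matrix.diagonal fun _ => (-2 : ℤ)

/-- The bilinear form of the lattice `E₈(2)` on `ℤ⁸`. -/
def B8 (x y : Fin 8 → ℤ) : ℤ := 2 * (x ⬝ᵥ E8G.mulVec y)

/-- A submodule `P ⊆ E₈(2)`, with the form divided by 2 (i.e. `P(1/2)`), is
isometric to the lattice with Gram matrix `G`. -/
def IsoHalf (P : Submodule ℤ (Fin 8 → ℤ)) {m : ℕ}
    (G : Matrix (Fin m) (Fin m) ℤ) : Prop :=
  ∃ e : ↥P ≃ₗ[ℤ] (Fin m → ℤ),
    ∀ x y : ↥P, B8 (x : Fin 8 → ℤ) (y : Fin 8 → ℤ) = 2 * ((e x) ⬝ᵥ G.mulVec (e y))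

/-- The positive definite `E₈` form on `ℤ⁸`. -/
def rootForm : LinearMap.BilinForm ℤ (Fin 8 → ℤ) := Matrix.toBilin' (-E8G)

theorem rootForm_eq_dotProduct (x y : Fin 8 → ℤ) :
    rootForm x y = -(x ⬝ᵥ E8G.mulVec y) := by
  rw [rootForm, Matrix.toBilin'_apply', Matrix.neg_mulVec, dotProduct_neg]

theorem B8_eq_rootForm (x y : Fin 8 → ℤ) : B8 x y = -2 * rootForm x y := by
  rw [rootForm_eq_dotProduct, B8]; ring

theorem rootForm_apply (x y : Fin 8 → ℤ) :
    rootForm x y = x 0 * (2 * y 0 - y 1) + x 1 * (2 * y 1 - y 0 - y 2)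
      + x 2 * (2 * y 2 - y 1 - y 3) + x 3 * (2 * y 3 - y 2 - y 4)
      + x 4 * (2 * y 4 - y 3 - y 5 - y 7) + x 5 * (2 * y 5 - y 4 - y 6)
      + x 6 * (2 * y 6 - y 5) + x 7 * (2 * y 7 - y 4) := by
  rw [rootForm_eq_dotProduct]
  simp [E8G, dotProduct, mulVec, Fin.sum_univ_eight]
  ring

theorem rootForm_comm (x y : Fin 8 → ℤ) : rootForm x y = rootForm y x := by
  rw [rootForm_apply, rootForm_apply]; ring

theorem rootForm_self_even (x : Fin 8 → ℤ) : Even (rootForm x x) := by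
  rw [rootForm_apply, even_iff_exists_two_mul]
  exact ⟨x 0 ^ 2 + x 1 ^ 2 + x 2 ^ 2 + x 3 ^ 2 + x 4 ^ 2 + x 5 ^ 2 + x 6 ^ 2 + x 7 ^ 2
    - x 0 * x 1 - x 1 * x 2 - x 2 * x 3 - x 3 * x 4 - x 4 * x 5 - x 5 * x 6 - x 4 * x 7, by ring⟩

theorem rootForm_self_sum_sq (x : Fin 8 → ℤ) :
    60 * rootForm x x = 30 * (2 * x 0 - x 1) ^ 2 + 10 * (3 * x 1 - 2 * x 2) ^ 2
      + 5 * (4 * x 2 - 3 * x 3) ^ 2 + 3 * (5 * x 3 - 4 * x 4) ^ 2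
      + 30 * (2 * x 6 - x 5) ^ 2 + 10 * (3 * x 5 - 2 * x 4) ^ 2
      + 30 * (2 * x 7 - x 4) ^ 2 + 2 * x 4 ^ 2 := by
  rw [rootForm_apply]; ring

theorem rootForm_self_nonneg (x : Fin 8 → ℤ) : 0 ≤ rootForm x x := by
  have h := rootForm_self_sum_sq x
  have : 0 ≤ 60 * rootForm x x := by rw [h]; positivity
  omega

theorem eq_zero_of_rootForm_self_nonpos {x : Fin 8 → ℤ} (hx : rootForm x x ≤ 0) : x = 0 := by
  have h := rootForm_self_sum_sq x
  have h0 := sq_nonneg (2 * x 0 - x 1)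
  have h1 := sq_nonneg (3 * x 1 - 2 * x 2)
  have h2 := sq_nonneg (4 * x 2 - 3 * x 3)
  have h3 := sq_nonneg (5 * x 3 - 4 * x 4)
  have h4 := sq_nonneg (2 * x 6 - x 5)
  have h5 := sq_nonneg (3 * x 5 - 2 * x 4)
  have h6 := sq_nonneg (2 * x 7 - x 4)
  have h7 := sq_nonneg (x 4)
  have e0 : 2 * x 0 - x 1 = 0 := pow_eq_zero_iff two_ne_zero |>.1 (by linarith)
  have e1 : 3 * x 1 - 2 * x 2 = 0 := pow_eq_zero_iff two_ne_zero |>.1 (by linarith)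
  have e2 : 4 * x 2 - 3 * x 3 = 0 := pow_eq_zero_iff two_ne_zero |>.1 (by linarith)
  have e3 : 5 * x 3 - 4 * x 4 = 0 := pow_eq_zero_iff two_ne_zero |>.1 (by linarith)
  have e4 : 2 * x 6 - x 5 = 0 := pow_eq_zero_iff two_ne_zero |>.1 (by linarith)
  have e5 : 3 * x 5 - 2 * x 4 = 0 := pow_eq_zero_iff two_ne_zero |>.1 (by linarith)
  have e6 : 2 * x 7 - x 4 = 0 := pow_eq_zero_iff two_ne_zero |>.1 (by linarith)
  have e7 : x 4 = 0 := pow_eq_zero_iff two_ne_zero |>.1 (by linarith)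
  ext i
  fin_cases i <;> simp <;> omega

theorem two_le_rootForm_self {x : Fin 8 → ℤ} (hx : x ≠ 0) : 2 ≤ rootForm x x := by
  have h1 : 0 < rootForm x x := by
    by_contra! h
    exact hx (eq_zero_of_rootForm_self_nonpos h)
  obtain ⟨k, hk⟩ := rootForm_self_even x
  omega

theorem rootForm_sub_self (x y : Fin 8 → ℤ) :
    rootForm (x - y) (x - y) = rootForm x x - 2 * rootForm x y + rootForm y y := by
  simp only [map_sub, LinearMap.sub_apply, rootForm_comm y x]; ring

theorem rootForm_add_self (x y : Fin 8 → ℤ) :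
    rootForm (x + y) (x + y) = rootForm x x + 2 * rootForm x y + rootForm y y := by
  simp only [map_add, LinearMap.add_apply, rootForm_comm y x]; ring

theorem two_mul_rootForm_le (x y : Fin 8 → ℤ) :
    2 * rootForm x y ≤ rootForm x x + rootForm y y := by
  have := rootForm_self_nonneg (x - y)
  rw [rootForm_sub_self] at this
  linarith

/-- The `i`-th simple root. -/
abbrev simpleRoot (i : Fin 8) : Fin 8 → ℤ := Pi.single i 1

theorem rootForm_simpleRoot_self (i : Fin 8) :
    rootForm (simpleRoot i) (simpleRoot i) = 2 := by
  rw [rootForm_apply]; fin_cases i <;> simp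

theorem eq_sum_simpleRoot (v : Fin 8 → ℤ) : v = ∑ i, v i • simpleRoot i := by
  ext j; simp [Finset.sum_apply, Pi.single_apply]

theorem rootForm_eq_sum (v w : Fin 8 → ℤ) :
    rootForm v w = ∑ i, v i * rootForm (simpleRoot i) w := by
  conv_lhs => rw [eq_sum_simpleRoot v]
  simp only [map_sum, map_smul, LinearMap.sum_apply, LinearMap.smul_apply, smul_eq_mul]

theorem nonneg_or_nonpos_of_root {r : Fin 8 → ℤ} (hr : rootForm r r = 2) :
    (∀ i, 0 ≤ r i) ∨ ∀ i, r i ≤ 0 := by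
  obtain ⟨p, hp⟩ : ∃ p : Fin 8 → ℤ, ∀ i, p i = max (r i) 0 := ⟨_, fun _ => rfl⟩
  obtain ⟨q, hq⟩ : ∃ q : Fin 8 → ℤ, ∀ i, q i = max (-r i) 0 := ⟨_, fun _ => rfl⟩
  have hrpq : r = p - q := by ext i; simp only [Pi.sub_apply, hp, hq]; omega
  have hp0 : ∀ i, 0 ≤ p i := fun i => by simp [hp]
  have hq0 : ∀ i, 0 ≤ q i := fun i => by simp [hq]
  have hpq : ∀ i, p i * q i = 0 := fun i => by
    rw [mul_eq_zero, hp, hq]; omega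
  have hle : rootForm p q ≤ 0 := by
    have h := fun i j => mul_nonneg (hp0 i) (hq0 j)
    rw [rootForm_apply]
    linarith [h 0 1, h 1 0, h 1 2, h 2 1, h 2 3, h 3 2, h 3 4, h 4 3, h 4 5, h 5 4, h 5 6, h 6 5,
      h 4 7, h 7 4, hpq 0, hpq 1, hpq 2, hpq 3, hpq 4, hpq 5, hpq 6, hpq 7]
  rw [hrpq, rootForm_sub_self] at hr
  by_cases hpz : p = 0
  · right
    intro i
    have := hp i
    rw [hpz, Pi.zero_apply] at this
    omega
  by_cases hqz : q = 0
  · left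
    intro i
    have := hq i
    rw [hqz, Pi.zero_apply] at this
    omega
  linarith [two_le_rootForm_self hpz, two_le_rootForm_self hqz]

/-- Linear automorphisms of `ℤ⁸` preserving the `E₈` form. -/
def IsIsometry (g : (Fin 8 → ℤ) ≃ₗ[ℤ] (Fin 8 → ℤ)) : Prop :=
  ∀ x y, rootForm (g x) (g y) = rootForm x y

theorem IsIsometry.refl : IsIsometry (LinearEquiv.refl ℤ _) := fun _ _ => rfl

theorem IsIsometry.trans {g h : (Fin 8 → ℤ) ≃ₗ[ℤ] (Fin 8 → ℤ)} (hg : IsIsometry g)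
    (hh : IsIsometry h) : IsIsometry (g.trans h) :=
  fun x y => (hh _ _).trans (hg x y)

/-- The reflection in a root. -/
noncomputable def rootReflection (r : Fin 8 → ℤ) (hr : rootForm r r = 2) :
    (Fin 8 → ℤ) ≃ₗ[ℤ] (Fin 8 → ℤ) :=
  Module.reflection hr

theorem rootReflection_apply {r : Fin 8 → ℤ} (hr : rootForm r r = 2) (x : Fin 8 → ℤ) :
    rootReflection r hr x = x - rootForm r x • r :=
  Module.reflection_apply _ _

theorem isIsometry_rootReflection {r : Fin 8 → ℤ} (hr : rootForm r r = 2) :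
    IsIsometry (rootReflection r hr) := by
  intro x y
  simp only [rootReflection_apply, map_sub, map_smul, LinearMap.sub_apply, LinearMap.smul_apply,
    hr, rootForm_comm x r, smul_eq_mul]
  ring

/-- The half sum of the positive roots. -/
def weylVector : Fin 8 → ℤ := ![29, 57, 84, 110, 135, 91, 46, 68]

theorem rootForm_simpleRoot_weylVector (i : Fin 8) :
    rootForm (simpleRoot i) weylVector = 1 := by
  rw [rootForm_apply]; fin_cases i <;> simp [weylVector]

theorem rootForm_weylVector (v : Fin 8 → ℤ) : rootForm weylVector v = ∑ i, v i := by
  rw [rootForm_comm, rootForm_eq_sum]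
  simp [rootForm_simpleRoot_weylVector]

set_option maxRecDepth 100000 in
theorem eq_self_of_maps_simpleRoot {σ : Fin 8 → Fin 8}
    (h : ∀ i j, rootForm (simpleRoot (σ i)) (simpleRoot (σ j)) =
      rootForm (simpleRoot i) (simpleRoot j)) (i : Fin 8) : σ i = i := by
  have key : ∀ i j, E8G (σ i) (σ j) = E8G i j := by
    intro i j
    have := h i j
    simpa [rootForm] using this
  have key' : ∀ {i k}, σ i = k → ∀ j, E8G k (σ j) = E8G i j := by
    rintro i _ rfl j
    exact key i j
  have h4 : σ 4 = 4 := by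
    have : ∀ p : Fin 8 × Fin 8 × Fin 8 × Fin 8, E8G p.1 p.2.1 = E8G 4 3 →
        E8G p.1 p.2.2.1 = E8G 4 5 → E8G p.2.1 p.2.2.1 = E8G 3 5 → E8G p.1 p.2.2.2 = E8G 4 7 →
        E8G p.2.1 p.2.2.2 = E8G 3 7 → E8G p.2.2.1 p.2.2.2 = E8G 5 7 → p.1 = 4 := by
      decide +kernel
    exact this (_, _, _, _) (key 4 3) (key 4 5) (key 3 5) (key 4 7) (key 3 7) (key 5 7)
  have h3 : σ 3 = 3 := by
    have : ∀ p : Fin 8 × Fin 8 × Fin 8, E8G 4 p.1 = E8G 4 3 → E8G p.1 p.2.1 = E8G 3 2 →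
        E8G 4 p.2.1 = E8G 4 2 → E8G p.2.1 p.2.2 = E8G 2 1 → E8G p.1 p.2.2 = E8G 3 1 →
        p.1 = 3 := by
      decide +kernel
    exact this (_, _, _) (key' h4 3) (key 3 2) (key' h4 2) (key 2 1) (key 3 1)
  have h2 : σ 2 = 2 := by
    have : ∀ a, E8G 3 a = E8G 3 2 → E8G 4 a = E8G 4 2 → a = 2 := by decide +kernel
    exact this _ (key' h3 2) (key' h4 2)
  have h1 : σ 1 = 1 := by
    have : ∀ a, E8G 2 a = E8G 2 1 → E8G 3 a = E8G 3 1 → a = 1 := by decide +kernel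
    exact this _ (key' h2 1) (key' h3 1)
  have h0 : σ 0 = 0 := by
    have : ∀ a, E8G 1 a = E8G 1 0 → E8G 2 a = E8G 2 0 → a = 0 := by decide +kernel
    exact this _ (key' h1 0) (key' h2 0)
  have h5 : σ 5 = 5 := by
    have : ∀ p : Fin 8 × Fin 8, E8G 4 p.1 = E8G 4 5 → E8G 3 p.1 = E8G 3 5 →
        E8G p.1 p.2 = E8G 5 6 → E8G 4 p.2 = E8G 4 6 → p.1 = 5 := by
      decide +kernel
    exact this (_, _) (key' h4 5) (key' h3 5) (key 5 6) (key' h4 6)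
  have h6 : σ 6 = 6 := by
    have : ∀ a, E8G 5 a = E8G 5 6 → E8G 4 a = E8G 4 6 → a = 6 := by decide +kernel
    exact this _ (key' h5 6) (key' h4 6)
  have h7 : σ 7 = 7 := by
    have : ∀ a, E8G 4 a = E8G 4 7 → E8G 3 a = E8G 3 7 → E8G 5 a = E8G 5 7 → a = 7 := by
      decide +kernel
    exact this _ (key' h4 7) (key' h3 7) (key' h5 7)
  fin_cases i <;> assumption

/-- An involutive isometry preserving the positive cone is trivial. -/
theorem eq_id_of_nonneg {θ : (Fin 8 → ℤ) →ₗ[ℤ] (Fin 8 → ℤ)}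
    (hisom : ∀ x y, rootForm (θ x) (θ y) = rootForm x y) (hinv : ∀ x, θ (θ x) = x)
    (hpos : ∀ i j, 0 ≤ θ (simpleRoot i) j) (x : Fin 8 → ℤ) : θ x = x := by
  have hone : ∀ i, 1 ≤ ∑ j, θ (simpleRoot i) j := by
    intro i
    have h0 : 0 ≤ ∑ j, θ (simpleRoot i) j := Finset.sum_nonneg fun j _ => hpos i j
    by_contra! hlt
    have hz : ∑ j, θ (simpleRoot i) j = 0 := by omega
    rw [Finset.sum_eq_zero_iff_of_nonneg fun j _ => hpos i j] at hz
    have hz' : θ (simpleRoot i) = 0 := funext fun j => hz j (Finset.mem_univ j)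
    have := hinv (simpleRoot i)
    rw [hz', map_zero] at this
    have := congrFun this i
    simp at this
  have hsum : ∀ i, ∑ j, θ (simpleRoot i) j = 1 := by
    intro i
    refine le_antisymm ?_ (hone i)
    have h1 : ∑ k, θ (θ (simpleRoot i)) k = 1 := by rw [hinv]; simp
    have h2 : ∑ k, θ (θ (simpleRoot i)) k =
        ∑ j, θ (simpleRoot i) j * ∑ k, θ (simpleRoot j) k := by
      conv_lhs => rw [eq_sum_simpleRoot (θ (simpleRoot i))]
      simp only [map_sum, map_smul, Finset.sum_apply, Pi.smul_apply, smul_eq_mul]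
      rw [Finset.sum_comm]
      simp only [Finset.mul_sum]
    rw [← h1, h2]
    exact Finset.sum_le_sum fun j _ => le_mul_of_one_le_right (hpos i j) (hone j)
  have hex : ∀ i, ∃ j, θ (simpleRoot i) = simpleRoot j := by
    intro i
    obtain ⟨j, -, hj⟩ : ∃ j ∈ Finset.univ, 0 < θ (simpleRoot i) j := by
      by_contra! hle
      have := Finset.sum_nonpos hle
      linarith [hsum i]
    refine ⟨j, ?_⟩
    have hs := hsum i
    rw [← Finset.add_sum_erase _ _ (Finset.mem_univ j)] at hs
    have hn := Finset.sum_nonneg (s := Finset.univ.erase j) fun k _ => hpos i k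
    have hz : ∑ k ∈ Finset.univ.erase j, θ (simpleRoot i) k = 0 := by omega
    rw [Finset.sum_eq_zero_iff_of_nonneg fun k _ => hpos i k] at hz
    ext k
    by_cases hk : k = j
    · subst hk; simp; omega
    · simpa [Pi.single_apply, hk] using hz k (by simp [hk])
  choose σ hσ using hex
  have hid : ∀ i, θ (simpleRoot i) = simpleRoot i := by
    intro i
    rw [hσ, eq_self_of_maps_simpleRoot (σ := σ) fun i j => by rw [← hσ, ← hσ, hisom]]
  conv_lhs => rw [eq_sum_simpleRoot x]
  conv_rhs => rw [eq_sum_simpleRoot x]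
  rw [map_sum]
  exact Finset.sum_congr rfl fun i _ => by rw [map_smul, hid]

/-- A vector whose pairing with `v` reads the coordinates of `v` as digits in base `100`. -/
theorem exists_rootForm_eq_digits : ∃ y : Fin 8 → ℤ, ∀ v, rootForm y v =
    v 0 + 100 * v 1 + 100 ^ 2 * v 2 + 100 ^ 3 * v 3 + 100 ^ 4 * v 4 + 100 ^ 5 * v 5
      + 100 ^ 6 * v 6 + 100 ^ 7 * v 7 := by
  refine ⟨Matrix.mulVec !![2, 3, 4, 5, 6, 4, 2, 3;
      3, 6, 8, 10, 12, 8, 4, 6;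
      4, 8, 12, 15, 18, 12, 6, 9;
      5, 10, 15, 20, 24, 16, 8, 12;
      6, 12, 18, 24, 30, 20, 10, 15;
      4, 8, 12, 16, 20, 14, 7, 10;
      2, 4, 6, 8, 10, 7, 4, 5;
      3, 6, 9, 12, 15, 10, 5, 8] ![1, 100, 100 ^ 2, 100 ^ 3, 100 ^ 4, 100 ^ 5, 100 ^ 6, 100 ^ 7],
    fun v => ?_⟩
  rw [rootForm_apply]
  simp [mulVec, dotProduct, Fin.sum_univ_eight]
  ring

theorem abs_coord_le_of_rootForm_self_le {w : Fin 8 → ℤ} (hw : rootForm w w ≤ 8) (i : Fin 8) :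
    |w i| ≤ 40 := by
  have h := rootForm_self_sum_sq w
  have h0 := sq_nonneg (2 * w 0 - w 1)
  have h1 := sq_nonneg (3 * w 1 - 2 * w 2)
  have h2 := sq_nonneg (4 * w 2 - 3 * w 3)
  have h3 := sq_nonneg (5 * w 3 - 4 * w 4)
  have h4 := sq_nonneg (2 * w 6 - w 5)
  have h5 := sq_nonneg (3 * w 5 - 2 * w 4)
  have h6 := sq_nonneg (2 * w 7 - w 4)
  have h7 := sq_nonneg (w 4)
  have a0 := abs_le.1 (abs_le_of_sq_le_sq (a := 2 * w 0 - w 1) (b := 4) (by linarith) (by norm_num))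
  have a1 := abs_le.1 (abs_le_of_sq_le_sq (a := 3 * w 1 - 2 * w 2) (b := 7) (by linarith) (by norm_num))
  have a2 := abs_le.1 (abs_le_of_sq_le_sq (a := 4 * w 2 - 3 * w 3) (b := 10) (by linarith) (by norm_num))
  have a3 := abs_le.1 (abs_le_of_sq_le_sq (a := 5 * w 3 - 4 * w 4) (b := 13) (by linarith) (by norm_num))
  have a4 := abs_le.1 (abs_le_of_sq_le_sq (a := 2 * w 6 - w 5) (b := 4) (by linarith) (by norm_num))
  have a5 := abs_le.1 (abs_le_of_sq_le_sq (a := 3 * w 5 - 2 * w 4) (b := 7) (by linarith) (by norm_num))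
  have a6 := abs_le.1 (abs_le_of_sq_le_sq (a := 2 * w 7 - w 4) (b := 4) (by linarith) (by norm_num))
  have a7 := abs_le.1 (abs_le_of_sq_le_sq (a := w 4) (b := 16) (by linarith) (by norm_num))
  rw [abs_le]
  fin_cases i <;> constructor <;> simp <;> omega

theorem eq_id_of_forall_root_ne {θ : (Fin 8 → ℤ) →ₗ[ℤ] (Fin 8 → ℤ)}
    (hisom : ∀ x y, rootForm (θ x) (θ y) = rootForm x y) (hinv : ∀ x, θ (θ x) = x)
    (hroot : ∀ r, rootForm r r = 2 → θ r ≠ -r) (x : Fin 8 → ℤ) : θ x = x := by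
  have hadj : ∀ u v, rootForm u (θ v) = rootForm (θ u) v := fun u v => by
    rw [← hisom, hinv]
  obtain ⟨y, hy⟩ := exists_rootForm_eq_digits
  obtain ⟨z, hz⟩ : ∃ z, z = y + θ y := ⟨_, rfl⟩
  have hzθ : ∀ v, rootForm z (θ v) = rootForm z v := fun v => by
    rw [hadj, hz, map_add, hinv, add_comm]
  have hzne : ∀ r, rootForm r r = 2 → rootForm z r ≠ 0 := by
    intro r hr h0
    have hw : rootForm y (r + θ r) = 0 := by
      rw [map_add, hadj, ← LinearMap.add_apply, ← map_add, ← hz, h0]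
    have hle : rootForm (r + θ r) (r + θ r) ≤ 8 := by
      have := two_mul_rootForm_le r (θ r)
      rw [rootForm_add_self]
      rw [hisom] at this ⊢
      linarith
    obtain ⟨w, hw'⟩ : ∃ w, w = r + θ r := ⟨_, rfl⟩
    rw [← hw'] at hw hle
    have hb := fun i => abs_le.1 (abs_coord_le_of_rootForm_self_le hle i)
    have hb0 := hb 0
    have hb1 := hb 1
    have hb2 := hb 2
    have hb3 := hb 3
    have hb4 := hb 4
    have hb5 := hb 5
    have hb6 := hb 6
    have hb7 := hb 7
    rw [hy] at hw
    have : w = 0 := by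
      ext i
      fin_cases i <;> simp <;> omega
    rw [this] at hw'
    exact hroot r hr (eq_neg_of_add_eq_zero_right hw'.symm)
  obtain ⟨_, ⟨g, hg, rfl⟩, hmax⟩ : ∃ m, (∃ g, IsIsometry g ∧ rootForm z (g weylVector) = m) ∧
      ∀ m', (∃ g, IsIsometry g ∧ rootForm z (g weylVector) = m') → m' ≤ m := by
    refine Int.exists_greatest_of_bdd
      ⟨rootForm z z + rootForm weylVector weylVector, ?_⟩ ⟨_, _, IsIsometry.refl, rfl⟩
    rintro _ ⟨g, hg, rfl⟩
    have := two_mul_rootForm_le z (g weylVector)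
    rw [hg] at this
    have h1 := rootForm_self_nonneg z
    have h2 := rootForm_self_nonneg weylVector
    linarith
  have hgpos : ∀ i, 0 < rootForm z (g (simpleRoot i)) := by
    intro i
    have h1 := hmax _ ⟨_, (isIsometry_rootReflection (rootForm_simpleRoot_self i)).trans hg, rfl⟩
    rw [LinearEquiv.trans_apply, rootReflection_apply, rootForm_simpleRoot_weylVector, one_smul,
      map_sub, map_sub] at h1
    have h2 := hzne (g (simpleRoot i)) (by rw [hg, rootForm_simpleRoot_self])
    omega
  have hgsymm : ∀ u v, rootForm (g.symm u) (g.symm v) = rootForm u v := fun u v => by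
    rw [← hg, g.apply_symm_apply, g.apply_symm_apply]
  have hfix := eq_id_of_nonneg (θ := g.symm.toLinearMap ∘ₗ θ ∘ₗ g.toLinearMap)
    (fun u v => by simp [hgsymm, hisom, hg u v]) (fun u => by simp [hinv]) ?_ (g.symm x)
  · simpa using hfix
  intro i
  obtain ⟨v, hv⟩ : ∃ v, v = g.symm (θ (g (simpleRoot i))) := ⟨_, rfl⟩
  have hvroot : rootForm v v = 2 := by
    rw [hv, hgsymm, hisom, hg, rootForm_simpleRoot_self]
  have hvpos : 0 < rootForm z (g v) := by
    rw [hv, g.apply_symm_apply, hzθ]; exact hgpos i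
  change ∀ j, 0 ≤ g.symm (θ (g (simpleRoot i))) j
  rw [← hv]
  refine (nonneg_or_nonpos_of_root hvroot).resolve_right fun hneg => hvpos.not_ge ?_
  rw [eq_sum_simpleRoot v]
  simp only [map_sum, map_smul, smul_eq_mul]
  exact Finset.sum_nonpos fun j _ => mul_nonpos_of_nonpos_of_nonneg (hneg j) (hgpos j).le

/-- A family of pairwise orthogonal roots. -/
def IsRootFrame {k : ℕ} (r : Fin k → Fin 8 → ℤ) : Prop :=
  ∀ i j, rootForm (r i) (r j) = if i = j then 2 else 0

theorem IsRootFrame.cons {k : ℕ} {r : Fin k → Fin 8 → ℤ} (hr : IsRootFrame r) {s : Fin 8 → ℤ}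
    (hs : rootForm s s = 2) (hsr : ∀ i, rootForm s (r i) = 0) :
    IsRootFrame (Fin.cons s r : Fin (k + 1) → Fin 8 → ℤ) := by
  intro i j
  refine Fin.cases ?_ (fun i => ?_) i <;> refine Fin.cases ?_ (fun j => ?_) j
  · simpa
  · simpa [(Fin.succ_ne_zero _).symm] using hsr j
  · simpa [rootForm_comm _ s] using hsr i
  · simpa using hr i j

theorem IsRootFrame.card_le {k : ℕ} {r : Fin k → Fin 8 → ℤ} (hr : IsRootFrame r) : k ≤ 8 := by
  have : LinearIndependent ℤ r := by
    rw [Fintype.linearIndependent_iff]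
    intro c hc i
    have := congrArg (rootForm (r i)) hc
    simp only [map_sum, map_smul, hr i, smul_eq_mul, map_zero] at this
    simpa using this
  simpa using this.fintype_card_le_finrank

/-- An involutive isometry is either a product of fewer than `n` reflections in pairwise
orthogonal roots, or negates `n` pairwise orthogonal roots. -/
theorem exists_rootFrame (n : ℕ) (θ : (Fin 8 → ℤ) →ₗ[ℤ] (Fin 8 → ℤ))
    (hisom : ∀ x y, rootForm (θ x) (θ y) = rootForm x y) (hinv : ∀ x, θ (θ x) = x) :
    (∃ k < n, ∃ r : Fin k → Fin 8 → ℤ, IsRootFrame r ∧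
      ∀ x, θ x = x - ∑ i, rootForm (r i) x • r i) ∨
    ∃ r : Fin n → Fin 8 → ℤ, IsRootFrame r ∧ ∀ i, θ (r i) = -r i := by
  induction n generalizing θ with
  | zero => exact Or.inr ⟨Fin.elim0, fun i => i.elim0, fun i => i.elim0⟩
  | succ n ih =>
    by_cases hroot : ∀ r, rootForm r r = 2 → θ r ≠ -r
    · exact Or.inl ⟨0, n.succ_pos, Fin.elim0, fun i => i.elim0,
        fun x => by simp [eq_id_of_forall_root_ne hisom hinv hroot x]⟩
    push Not at hroot
    obtain ⟨s, hs, hθs⟩ := hroot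
    have hsθ : ∀ x, rootForm s (θ x) = -rootForm s x := fun x => by
      rw [← hisom, hinv, hθs]; simp
    obtain ⟨θ', hθ'⟩ : ∃ θ' : (Fin 8 → ℤ) →ₗ[ℤ] (Fin 8 → ℤ),
        ∀ x, θ' x = θ x + rootForm s x • s :=
      ⟨θ + (rootForm s).smulRight s, fun x => rfl⟩
    have hneg : ∀ v, θ' v = -v → rootForm s v = 0 ∧ θ v = -v := by
      intro v hv
      have h1 := congrArg (rootForm s) hv
      rw [hθ', map_add, map_smul, hsθ, hs, map_neg, smul_eq_mul] at h1
      have h2 : rootForm s v = 0 := by omega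
      rw [hθ', h2, zero_smul, add_zero] at hv
      exact ⟨h2, hv⟩
    rcases ih θ' (fun x y => by
        simp only [hθ', map_add, map_smul, LinearMap.add_apply, LinearMap.smul_apply, hisom, hsθ,
          rootForm_comm _ s, hs, smul_eq_mul]
        ring) (fun x => by
        rw [hθ', hθ', map_add, map_add, map_smul, map_smul, hinv, hsθ, hs, hθs, smul_eq_mul]
        module) with ⟨k, hk, r, hr, hθr⟩ | ⟨r, hr, hθr⟩
    · left
      have h := fun i => hneg (r i) (by
        simp only [hθr, rootForm_comm _ (r i), hr i, ite_smul, zero_smul, Finset.sum_ite_eq,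
          Finset.mem_univ, if_true]
        module)
      refine ⟨k + 1, by omega, _, hr.cons hs fun i => (h i).1, fun x => ?_⟩
      have hx := hθr x
      rw [hθ'] at hx
      rw [Fin.sum_univ_succ]
      simp only [Fin.cons_zero, Fin.cons_succ]
      rw [eq_sub_of_add_eq hx]
      abel
    · right
      refine ⟨_, hr.cons hs fun i => (hneg _ (hθr i)).1, fun i => ?_⟩
      refine Fin.cases ?_ (fun i => ?_) i
      · simpa using hθs
      · simpa using (hneg _ (hθr i)).2

theorem rootForm_simpleRoot (i : Fin 8) (w : Fin 8 → ℤ) :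
    rootForm (simpleRoot i) w = -∑ j, E8G i j * w j := by
  rw [rootForm_eq_dotProduct, single_one_dotProduct]
  rfl

theorem sum_le_of_root {r : Fin 8 → ℤ} (hr : rootForm r r = 2) : ∑ i, r i ≤ 35 := by
  have h1 := rootForm_self_nonneg (weylVector - (18 : ℤ) • r)
  have h2 : rootForm weylVector weylVector = 620 := by
    rw [rootForm_weylVector]
    simp [Fin.sum_univ_eight, weylVector]
  rw [rootForm_sub_self, h2, map_smul, map_smul, map_smul, LinearMap.smul_apply, hr,
    rootForm_weylVector, smul_eq_mul, smul_eq_mul, smul_eq_mul] at h1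
  omega

/-- Every root supported on a subdiagram `I` can be moved to an `I`-dominant one by the parabolic
subgroup of `I`. -/
theorem exists_isometry_dominant (I : Finset (Fin 8)) {r : Fin 8 → ℤ} (hr : rootForm r r = 2)
    (hsupp : ∀ i ∉ I, r i = 0) :
    ∃ g, IsIsometry g ∧ (∀ v, (∀ i ∈ I, rootForm (simpleRoot i) v = 0) → g v = v) ∧
      (∀ i ∉ I, g r i = 0) ∧ ∀ i ∈ I, 0 ≤ rootForm (simpleRoot i) (g r) := by
  obtain ⟨n, hn⟩ : ∃ n : ℕ, 35 - ∑ i, r i ≤ n := ⟨_, Int.self_le_toNat _⟩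
  induction n generalizing r with
  | zero =>
    refine ⟨_, IsIsometry.refl, fun v _ => rfl, hsupp, fun i hi => ?_⟩
    by_contra! hlt
    change rootForm (simpleRoot i) r < 0 at hlt
    have hs := isIsometry_rootReflection (rootForm_simpleRoot_self i) r r
    have hle := sum_le_of_root (hs.trans hr)
    simp only [rootReflection_apply, Pi.sub_apply, Pi.smul_apply, Finset.sum_sub_distrib,
      smul_eq_mul, ← Finset.mul_sum, Finset.sum_pi_single', Finset.mem_univ, if_true,
      mul_one] at hle
    push_cast at hn
    omega
  | succ n ih =>
    by_cases hdom : ∀ i ∈ I, 0 ≤ rootForm (simpleRoot i) r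
    · exact ⟨_, IsIsometry.refl, fun v _ => rfl, hsupp, hdom⟩
    push Not at hdom
    obtain ⟨i, hi, hlt⟩ := hdom
    have hs := isIsometry_rootReflection (rootForm_simpleRoot_self i)
    obtain ⟨g, hg, hfix, hgsupp, hgdom⟩ := ih ((hs r r).trans hr) (fun j hj => by
      have hji : j ≠ i := fun h => hj (h ▸ hi)
      simp [rootReflection_apply, hsupp j hj, hji]) (by
      simp only [rootReflection_apply, Pi.sub_apply, Pi.smul_apply, Finset.sum_sub_distrib,
        smul_eq_mul, ← Finset.mul_sum, Finset.sum_pi_single', Finset.mem_univ, if_true, mul_one]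
      push_cast at hn
      omega)
    refine ⟨_, hs.trans hg, fun v hv => ?_, hgsupp, hgdom⟩
    rw [LinearEquiv.trans_apply, rootReflection_apply, hv i hi, zero_smul, sub_zero, hfix v hv]

theorem eq_of_dominant (I : Finset (Fin 8)) {r h : Fin 8 → ℤ} (hr : rootForm r r = 2)
    (hh : rootForm h h = 2) (hrs : ∀ i ∉ I, r i = 0) (hhs : ∀ i ∉ I, h i = 0)
    (hrd : ∀ i ∈ I, 0 ≤ rootForm (simpleRoot i) r)
    (hhd : ∀ i ∈ I, 0 ≤ rootForm (simpleRoot i) h) (hpos : 0 < rootForm r h) : r = h := by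
  have hnonneg : ∀ v d : Fin 8 → ℤ, (∀ i ∉ I, v i = 0) → (∀ i, 0 ≤ v i) →
      (∀ i ∈ I, 0 ≤ rootForm (simpleRoot i) d) → 0 ≤ rootForm v d := by
    intro v d hv0 hv hd
    rw [rootForm_eq_sum]
    refine Finset.sum_nonneg fun i _ => ?_
    by_cases hi : i ∈ I
    · exact mul_nonneg (hv i) (hd i hi)
    · simp [hv0 i hi]
  have hsub := rootForm_sub_self r h
  rw [hr, hh] at hsub
  by_cases h2 : 2 ≤ rootForm r h
  · exact sub_eq_zero.1 (eq_zero_of_rootForm_self_nonpos (by omega))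
  have h1 : rootForm r h = 1 := by omega
  exfalso
  rcases nonneg_or_nonpos_of_root (r := r - h) (by omega) with hn | hn
  · have := hnonneg (r - h) h (fun i hi => by simp [hrs i hi, hhs i hi]) hn hhd
    rw [map_sub, LinearMap.sub_apply, h1, hh] at this
    omega
  · have := hnonneg (h - r) r (fun i hi => by simp [hrs i hi, hhs i hi])
      (fun i => by have := hn i; simp only [Pi.sub_apply] at this ⊢; omega) hrd
    rw [map_sub, LinearMap.sub_apply, rootForm_comm h r, h1, hr] at this
    omega

/-- The highest root of `E₈`. -/
def highestRootE8 : Fin 8 → ℤ := ![2, 3, 4, 5, 6, 4, 2, 3]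

/-- The highest root of the subdiagram `E₇`. -/
def highestRootE7 : Fin 8 → ℤ := ![0, 1, 2, 3, 4, 3, 2, 2]

/-- The highest root of the subdiagram `D₆`. -/
def highestRootD6 : Fin 8 → ℤ := ![0, 1, 2, 2, 2, 1, 0, 1]

/-- The highest root of the subdiagram `D₄`. -/
def highestRootD4 : Fin 8 → ℤ := ![0, 0, 0, 1, 2, 1, 0, 1]

theorem exists_isometry_highestRootE8 {a : Fin 8 → ℤ} (ha : rootForm a a = 2) :
    ∃ g, IsIsometry g ∧ g a = highestRootE8 := by
  obtain ⟨g, hg, -, hs, hd⟩ := exists_isometry_dominant Finset.univ ha (by simp)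
  refine ⟨g, hg, ?_⟩
  have hr := (hg a a).trans ha
  generalize g a = w at hs hd hr ⊢
  refine eq_of_dominant Finset.univ hr (by rw [rootForm_apply]; simp [highestRootE8]) hs (by simp)
    hd ?_ ?_
  · intro i _
    rw [rootForm_simpleRoot]
    fin_cases i <;> simp [E8G, Fin.sum_univ_eight, highestRootE8]
  · by_contra! hle
    have h0 := hd 0 (by simp)
    have h1 := hd 1 (by simp)
    have h2 := hd 2 (by simp)
    have h3 := hd 3 (by simp)
    have h4 := hd 4 (by simp)
    have h5 := hd 5 (by simp)
    have h6 := hd 6 (by simp)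
    have h7 := hd 7 (by simp)
    simp only [rootForm_simpleRoot] at h0 h1 h2 h3 h4 h5 h6 h7
    rw [rootForm_apply] at hle
    simp [E8G, Fin.sum_univ_eight, highestRootE8] at h0 h1 h2 h3 h4 h5 h6 h7 hle
    have : w = 0 := by ext i; fin_cases i <;> simp <;> omega
    simp [this] at hr

theorem exists_isometry_highestRootE7 {a b : Fin 8 → ℤ} (hab : IsRootFrame ![a, b]) :
    ∃ g, IsIsometry g ∧ g a = highestRootE8 ∧ g b = highestRootE7 := by
  have haa : rootForm a a = 2 := hab 0 0
  have hab' : rootForm a b = 0 := hab 0 1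
  have hbb : rootForm b b = 2 := hab 1 1
  obtain ⟨f, hf, hfa⟩ := exists_isometry_highestRootE8 haa
  have hr := (hf b b).trans hbb
  have ho := (hf a b).trans hab'
  rw [hfa] at ho
  obtain ⟨g, hg, hfix, hs, hd⟩ := exists_isometry_dominant {1, 2, 3, 4, 5, 6, 7} hr (by
    rw [rootForm_apply] at ho
    simp [highestRootE8] at ho
    intro i hi
    fin_cases i <;> simp at hi ⊢
    omega)
  refine ⟨_, hf.trans hg, ?_, ?_⟩
  · rw [LinearEquiv.trans_apply, hfa]
    apply hfix
    intro i hi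
    rw [rootForm_simpleRoot]
    fin_cases i <;> simp at hi <;> simp [E8G, Fin.sum_univ_eight, highestRootE8]
  rw [LinearEquiv.trans_apply]
  replace hr := (hg _ _).trans hr
  generalize g (f b) = w at hs hd hr ⊢
  refine eq_of_dominant {1, 2, 3, 4, 5, 6, 7} hr
    (by rw [rootForm_apply]; simp [highestRootE7]) hs ?_ hd ?_ ?_
  · intro i hi
    fin_cases i <;> simp at hi; simp [highestRootE7]
  · intro i hi
    rw [rootForm_simpleRoot]
    fin_cases i <;> simp at hi <;> simp [E8G, Fin.sum_univ_eight, highestRootE7]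
  · by_contra! hle
    have h0 := hs 0 (by simp)
    have h1 := hd 1 (by simp)
    have h2 := hd 2 (by simp)
    have h3 := hd 3 (by simp)
    have h4 := hd 4 (by simp)
    have h5 := hd 5 (by simp)
    have h6 := hd 6 (by simp)
    have h7 := hd 7 (by simp)
    simp only [rootForm_simpleRoot] at h1 h2 h3 h4 h5 h6 h7
    rw [rootForm_apply] at hle
    simp [E8G, Fin.sum_univ_eight, highestRootE7] at h0 h1 h2 h3 h4 h5 h6 h7 hle
    have : w = 0 := by ext i; fin_cases i <;> simp <;> omega
    simp [this] at hr

theorem exists_isometry_highestRootD6 {a b c : Fin 8 → ℤ} (habc : IsRootFrame ![a, b, c]) :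
    ∃ g, IsIsometry g ∧ g a = highestRootE8 ∧ g b = highestRootE7 ∧ g c = highestRootD6 := by
  have hab : IsRootFrame ![a, b] := fun i j => by
    have := habc i.castSucc j.castSucc
    fin_cases i <;> fin_cases j <;> simpa using this
  have hac : rootForm a c = 0 := habc 0 2
  have hbc : rootForm b c = 0 := habc 1 2
  have hcc : rootForm c c = 2 := habc 2 2
  obtain ⟨f, hf, hfa, hfb⟩ := exists_isometry_highestRootE7 hab
  have hr := (hf c c).trans hcc
  have ho1 := (hf a c).trans hac
  have ho2 := (hf b c).trans hbc
  rw [hfa] at ho1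
  rw [hfb] at ho2
  obtain ⟨g, hg, hfix, hs, hd⟩ := exists_isometry_dominant {1, 2, 3, 4, 5, 7} hr (by
    rw [rootForm_apply] at ho1 ho2
    simp [highestRootE8, highestRootE7] at ho1 ho2
    intro i hi
    fin_cases i <;> simp at hi ⊢ <;> omega)
  refine ⟨_, hf.trans hg, ?_, ?_, ?_⟩
  · rw [LinearEquiv.trans_apply, hfa]
    apply hfix
    intro i hi
    rw [rootForm_simpleRoot]
    fin_cases i <;> simp at hi <;> simp [E8G, Fin.sum_univ_eight, highestRootE8]
  · rw [LinearEquiv.trans_apply, hfb]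
    apply hfix
    intro i hi
    rw [rootForm_simpleRoot]
    fin_cases i <;> simp at hi <;> simp [E8G, Fin.sum_univ_eight, highestRootE7]
  rw [LinearEquiv.trans_apply]
  replace hr := (hg _ _).trans hr
  generalize g (f c) = w at hs hd hr ⊢
  refine eq_of_dominant {1, 2, 3, 4, 5, 7} hr
    (by rw [rootForm_apply]; simp [highestRootD6]) hs ?_ hd ?_ ?_
  · intro i hi
    fin_cases i <;> simp at hi <;> simp [highestRootD6]
  · intro i hi
    rw [rootForm_simpleRoot]
    fin_cases i <;> simp at hi <;> simp [E8G, Fin.sum_univ_eight, highestRootD6]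
  · by_contra! hle
    have h0 := hs 0 (by simp)
    have h1 := hd 1 (by simp)
    have h2 := hd 2 (by simp)
    have h3 := hd 3 (by simp)
    have h4 := hd 4 (by simp)
    have h5 := hd 5 (by simp)
    have h6 := hs 6 (by simp)
    have h7 := hd 7 (by simp)
    simp only [rootForm_simpleRoot] at h1 h2 h3 h4 h5 h7
    rw [rootForm_apply] at hle
    simp [E8G, Fin.sum_univ_eight, highestRootD6] at h0 h1 h2 h3 h4 h5 h6 h7 hle
    have : w = 0 := by ext i; fin_cases i <;> simp <;> omega
    simp [this] at hr

theorem exists_isometry_frame_four {a b c d : Fin 8 → ℤ} (habcd : IsRootFrame ![a, b, c, d]) :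
    ∃ g, IsIsometry g ∧ g a = highestRootE8 ∧ g b = highestRootE7 ∧ g c = highestRootD6 ∧
      (g d = simpleRoot 1 ∨ g d = highestRootD4) := by
  have habc : IsRootFrame ![a, b, c] := fun i j => by
    have := habcd i.castSucc j.castSucc
    fin_cases i <;> fin_cases j <;> simpa using this
  have had : rootForm a d = 0 := habcd 0 3
  have hbd : rootForm b d = 0 := habcd 1 3
  have hcd : rootForm c d = 0 := habcd 2 3
  have hdd : rootForm d d = 2 := habcd 3 3
  obtain ⟨f, hf, hfa, hfb, hfc⟩ := exists_isometry_highestRootD6 habc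
  have hr := (hf d d).trans hdd
  have ho1 := (hf a d).trans had
  have ho2 := (hf b d).trans hbd
  have ho3 := (hf c d).trans hcd
  rw [hfa] at ho1
  rw [hfb] at ho2
  rw [hfc] at ho3
  obtain ⟨g, hg, hfix, hs, hd⟩ := exists_isometry_dominant {1, 3, 4, 5, 7} hr (by
    rw [rootForm_apply] at ho1 ho2 ho3
    simp [highestRootE8, highestRootE7, highestRootD6] at ho1 ho2 ho3
    intro i hi
    fin_cases i <;> simp at hi ⊢ <;> omega)
  refine ⟨_, hf.trans hg, ?_, ?_, ?_, ?_⟩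
  · rw [LinearEquiv.trans_apply, hfa]
    apply hfix
    intro i hi
    rw [rootForm_simpleRoot]
    fin_cases i <;> simp at hi <;> simp [E8G, Fin.sum_univ_eight, highestRootE8]
  · rw [LinearEquiv.trans_apply, hfb]
    apply hfix
    intro i hi
    rw [rootForm_simpleRoot]
    fin_cases i <;> simp at hi <;> simp [E8G, Fin.sum_univ_eight, highestRootE7]
  · rw [LinearEquiv.trans_apply, hfc]
    apply hfix
    intro i hi
    rw [rootForm_simpleRoot]
    fin_cases i <;> simp at hi <;> simp [E8G, Fin.sum_univ_eight, highestRootD6]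
  rw [LinearEquiv.trans_apply]
  replace hr := (hg _ _).trans hr
  generalize g (f d) = w at hs hd hr ⊢
  by_cases hpos : 0 < rootForm w highestRootD4
  · right
    refine eq_of_dominant {1, 3, 4, 5, 7} hr
      (by rw [rootForm_apply]; simp [highestRootD4]) hs ?_ hd ?_ hpos
    · intro i hi
      fin_cases i <;> simp at hi <;> simp [highestRootD4]
    · intro i hi
      rw [rootForm_simpleRoot]
      fin_cases i <;> simp at hi <;> simp [E8G, Fin.sum_univ_eight, highestRootD4]
  left
  refine eq_of_dominant {1, 3, 4, 5, 7} hr (rootForm_simpleRoot_self 1) hs ?_ hd ?_ ?_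
  · intro i hi
    fin_cases i <;> simp at hi <;> simp
  · intro i hi
    rw [rootForm_simpleRoot]
    fin_cases i <;> simp at hi <;> simp [E8G, Fin.sum_univ_eight]
  · by_contra! hle
    have h0 := hs 0 (by simp)
    have h1 := hd 1 (by simp)
    have h2 := hs 2 (by simp)
    have h3 := hd 3 (by simp)
    have h4 := hd 4 (by simp)
    have h5 := hd 5 (by simp)
    have h6 := hs 6 (by simp)
    have h7 := hd 7 (by simp)
    simp only [rootForm_simpleRoot] at h1 h3 h4 h5 h7
    rw [rootForm_apply] at hle hpos
    simp [E8G, Fin.sum_univ_eight, highestRootD4] at h0 h1 h2 h3 h4 h5 h6 h7 hle hpos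
    have : w = 0 := by ext i; fin_cases i <;> simp <;> omega
    simp [this] at hr

/-- `P` cuts out a sublattice of `E₈` with a basis, the rows of `M`, whose Gram matrix is `G`; the
columns of `N` are the coordinate functions of that basis. -/
def HasBasis (P : (Fin 8 → ℤ) → Prop) {m : ℕ} (G : Matrix (Fin m) (Fin m) ℤ)
    (M : Matrix (Fin m) (Fin 8) ℤ) (N : Matrix (Fin 8) (Fin m) ℤ) : Prop :=
  M * N = 1 ∧ M * E8G * Mᵀ = G ∧ ∀ w, P w ↔ w = (w ᵥ* N) ᵥ* M

theorem HasBasis.isoHalf {P : (Fin 8 → ℤ) → Prop} {m : ℕ} {G : Matrix (Fin m) (Fin m) ℤ}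
    {M : Matrix (Fin m) (Fin 8) ℤ} {N : Matrix (Fin 8) (Fin m) ℤ} (h : HasBasis P G M N)
    {g : (Fin 8 → ℤ) ≃ₗ[ℤ] (Fin 8 → ℤ)} (hg : IsIsometry g) {S : Submodule ℤ (Fin 8 → ℤ)}
    (hS : ∀ x, x ∈ S ↔ P (g x)) : IsoHalf S G := by
  obtain ⟨hMN, hG, hP⟩ := h
  have hinv : ∀ c : Fin m → ℤ, (c ᵥ* M) ᵥ* N = c := fun c => by
    rw [vecMul_vecMul, hMN, vecMul_one]
  have hmem : ∀ x ∈ S, (g x ᵥ* N) ᵥ* M = g x := fun x hx => ((hP _).1 ((hS x).1 hx)).symm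
  refine ⟨LinearEquiv.ofBijective ((N.vecMulLinear.comp g.toLinearMap).comp S.subtype)
    ⟨fun x y hxy => ?_, fun c => ?_⟩, fun x y => ?_⟩
  · have hxy : g x ᵥ* N = g y ᵥ* N := hxy
    exact Subtype.ext (g.injective (by rw [← hmem x x.2, ← hmem y y.2, hxy]))
  · refine ⟨⟨g.symm (c ᵥ* M), ?_⟩, ?_⟩
    · rw [hS, hP, LinearEquiv.apply_symm_apply, hinv]
    · change g (g.symm (c ᵥ* M)) ᵥ* N = c
      rw [LinearEquiv.apply_symm_apply, hinv]
  · change B8 x y = 2 * ((g x ᵥ* N) ⬝ᵥ G *ᵥ (g y ᵥ* N))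
    have hB : B8 x y = B8 (g x) (g y) := by rw [B8_eq_rootForm, B8_eq_rootForm, hg]
    rw [hB, ← hG, B8]
    conv_lhs => rw [← hmem x x.2, ← hmem y y.2]
    rw [← mulVec_mulVec, ← mulVec_mulVec, dotProduct_mulVec _ M, mulVec_transpose]

/-- `w` is orthogonal to all the `r i`. -/
def Orthogonal {k : ℕ} (r : Fin k → Fin 8 → ℤ) (w : Fin 8 → ℤ) : Prop :=
  ∀ i, rootForm (r i) w = 0

/-- `w` is negated by the product of the reflections in the orthogonal roots `r i`. -/
def AntiFixed {k : ℕ} (r : Fin k → Fin 8 → ℤ) (w : Fin 8 → ℤ) : Prop :=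
  (2 : ℤ) • w = ∑ i, rootForm (r i) w • r i

theorem exists_eq_vecCons (w : Fin 8 → ℤ) :
    ∃ a b c d e f g h, w = ![a, b, c, d, e, f, g, h] :=
  ⟨w 0, w 1, w 2, w 3, w 4, w 5, w 6, w 7, by ext i; fin_cases i <;> rfl⟩

theorem hasBasis_orthogonal_zero (r : Fin 0 → Fin 8 → ℤ) : HasBasis (Orthogonal r) E8G 1 1 :=
  ⟨by simp, by simp, by simp [Orthogonal]⟩

theorem hasBasis_antiFixed_zero (r : Fin 0 → Fin 8 → ℤ) :
    HasBasis (AntiFixed r) (A1pow 0) 0 0 :=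
  ⟨by ext i; exact i.elim0, by ext i; exact i.elim0, by simp [AntiFixed, -zsmul_eq_mul]⟩

theorem hasBasis_orthogonal_one :
    HasBasis (Orthogonal ![highestRootE8]) E7G
      !![0, 1, 0, 0, 0, 0, 0, 0;
         0, 0, 1, 0, 0, 0, 0, 0;
         0, 0, 0, 1, 0, 0, 0, 0;
         0, 0, 0, 0, 1, 0, 0, 0;
         0, 0, 0, 0, 0, 1, 0, 0;
         0, 0, 0, 0, 0, 0, 1, 0;
         0, 0, 0, 0, 0, 0, 0, 1]
      !![0, 0, 0, 0, 0, 0, 0;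
         1, 0, 0, 0, 0, 0, 0;
         0, 1, 0, 0, 0, 0, 0;
         0, 0, 1, 0, 0, 0, 0;
         0, 0, 0, 1, 0, 0, 0;
         0, 0, 0, 0, 1, 0, 0;
         0, 0, 0, 0, 0, 1, 0;
         0, 0, 0, 0, 0, 0, 1] := by
  refine ⟨by decide, by decide, fun w => ?_⟩
  obtain ⟨a, b, c, d, e, f, g, h, rfl⟩ := exists_eq_vecCons w
  simp [Orthogonal, rootForm_apply, highestRootE8, funext_iff, Fin.forall_fin_succ]
  omega

theorem hasBasis_antiFixed_one :
    HasBasis (AntiFixed ![highestRootE8]) (A1pow 1)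
      !![2, 3, 4, 5, 6, 4, 2, 3]
      !![-1;
         1;
         0;
         0;
         0;
         0;
         0;
         0] := by
  refine ⟨by decide, by decide, fun w => ?_⟩
  obtain ⟨a, b, c, d, e, f, g, h, rfl⟩ := exists_eq_vecCons w
  simp [AntiFixed, rootForm_apply, highestRootE8, funext_iff, Fin.forall_fin_succ]
  omega

theorem hasBasis_orthogonal_two :
    HasBasis (Orthogonal ![highestRootE8, highestRootE7]) D6G
      !![0, 1, 0, 0, 0, 0, 0, 0;
         0, 0, 1, 0, 0, 0, 0, 0;
         0, 0, 0, 1, 0, 0, 0, 0;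
         0, 0, 0, 0, 1, 0, 0, 0;
         0, 0, 0, 0, 0, 1, 0, 0;
         0, 0, 0, 0, 0, 0, 0, 1]
      !![0, 0, 0, 0, 0, 0;
         1, 0, 0, 0, 0, 0;
         0, 1, 0, 0, 0, 0;
         0, 0, 1, 0, 0, 0;
         0, 0, 0, 1, 0, 0;
         0, 0, 0, 0, 1, 0;
         0, 0, 0, 0, 0, 0;
         0, 0, 0, 0, 0, 1] := by
  refine ⟨by decide, by decide, fun w => ?_⟩
  obtain ⟨a, b, c, d, e, f, g, h, rfl⟩ := exists_eq_vecCons w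
  simp [Orthogonal, rootForm_apply, highestRootE8, highestRootE7, funext_iff, Fin.forall_fin_succ]
  omega

set_option maxHeartbeats 800000 in
theorem hasBasis_antiFixed_two :
    HasBasis (AntiFixed ![highestRootE8, highestRootE7]) (A1pow 2)
      !![2, 3, 4, 5, 6, 4, 2, 3;
         0, 1, 2, 3, 4, 3, 2, 2]
      !![0, 0;
         0, -1;
         1, 0;
         0, 0;
         0, 0;
         0, 0;
         0, 0;
         -1, 1] := by
  refine ⟨by decide, by decide, fun w => ?_⟩
  obtain ⟨a, b, c, d, e, f, g, h, rfl⟩ := exists_eq_vecCons w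
  simp [AntiFixed, rootForm_apply, highestRootE8, highestRootE7, funext_iff, Fin.forall_fin_succ,
    Fin.sum_univ_succ]
  omega

theorem hasBasis_orthogonal_three :
    HasBasis (Orthogonal ![highestRootE8, highestRootE7, highestRootD6]) D4A1G
      !![0, 0, 0, 0, 1, 0, 0, 0;
         0, 0, 0, 1, 0, 0, 0, 0;
         0, 0, 0, 0, 0, 1, 0, 0;
         0, 0, 0, 0, 0, 0, 0, 1;
         0, 1, 0, 0, 0, 0, 0, 0]
      !![0, 0, 0, 0, 0;
         0, 0, 0, 0, 1;
         0, 0, 0, 0, 0;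
         0, 1, 0, 0, 0;
         1, 0, 0, 0, 0;
         0, 0, 1, 0, 0;
         0, 0, 0, 0, 0;
         0, 0, 0, 1, 0] := by
  refine ⟨by decide, by decide, fun w => ?_⟩
  obtain ⟨a, b, c, d, e, f, g, h, rfl⟩ := exists_eq_vecCons w
  simp [Orthogonal, rootForm_apply, highestRootE8, highestRootE7, highestRootD6, funext_iff,
    Fin.forall_fin_succ]
  omega

theorem hasBasis_antiFixed_three :
    HasBasis (AntiFixed ![highestRootE8, highestRootE7, highestRootD6]) (A1pow 3)
      !![2, 3, 4, 5, 6, 4, 2, 3;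
         0, 1, 2, 3, 4, 3, 2, 2;
         0, 1, 2, 2, 2, 1, 0, 1]
      !![0, 0, -2;
         1, -1, 3;
         0, 0, 0;
         -1, 0, -1;
         0, 0, 0;
         0, 0, 0;
         0, 0, 0;
         1, 1, 0] := by
  refine ⟨by decide, by decide, fun w => ?_⟩
  obtain ⟨a, b, c, d, e, f, g, h, rfl⟩ := exists_eq_vecCons w
  simp [AntiFixed, rootForm_apply, highestRootE8, highestRootE7, highestRootD6, funext_iff,
    Fin.forall_fin_succ, Fin.sum_univ_succ]
  omega

theorem hasBasis_orthogonal_four :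
    HasBasis (Orthogonal ![highestRootE8, highestRootE7, highestRootD6, simpleRoot 1]) D4G
      !![0, 0, 0, 0, 1, 0, 0, 0;
         0, 0, 0, 1, 0, 0, 0, 0;
         0, 0, 0, 0, 0, 1, 0, 0;
         0, 0, 0, 0, 0, 0, 0, 1]
      !![0, 0, 0, 0;
         0, 0, 0, 0;
         0, 0, 0, 0;
         0, 1, 0, 0;
         1, 0, 0, 0;
         0, 0, 1, 0;
         0, 0, 0, 0;
         0, 0, 0, 1] := by
  refine ⟨by decide, by decide, fun w => ?_⟩
  obtain ⟨a, b, c, d, e, f, g, h, rfl⟩ := exists_eq_vecCons w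
  simp [Orthogonal, rootForm_apply, highestRootE8, highestRootE7, highestRootD6, funext_iff,
    Fin.forall_fin_succ]
  omega

theorem hasBasis_antiFixed_four :
    HasBasis (AntiFixed ![highestRootE8, highestRootE7, highestRootD6, simpleRoot 1]) D4G
      !![1, 3, 4, 5, 6, 4, 2, 3;
         -2, -3, -4, -5, -6, -4, -2, -3;
         0, -1, -2, -3, -4, -3, -2, -2;
         0, -1, -2, -2, -2, -1, 0, -1]
      !![-1, -1, 0, 0;
         2, 1, 1, 1;
         -1, 0, 0, -2;
         0, -1, 0, 1;
         0, 0, 0, 0;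
         0, 0, 0, 0;
         0, 0, 0, 0;
         0, 1, -1, 0] := by
  refine ⟨by decide, by decide, fun w => ?_⟩
  obtain ⟨a, b, c, d, e, f, g, h, rfl⟩ := exists_eq_vecCons w
  simp [AntiFixed, rootForm_apply, highestRootE8, highestRootE7, highestRootD6, funext_iff,
    Fin.forall_fin_succ, Fin.sum_univ_succ]
  omega

theorem hasBasis_orthogonal_four' :
    HasBasis (Orthogonal ![highestRootE8, highestRootE7, highestRootD6, highestRootD4]) (A1pow 4)
      !![0, 1, 0, 0, 0, 0, 0, 0;
         0, 0, 0, 1, 0, 0, 0, 0;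
         0, 0, 0, 0, 0, 1, 0, 0;
         0, 0, 0, 0, 0, 0, 0, 1]
      !![0, 0, 0, 0;
         1, 0, 0, 0;
         0, 0, 0, 0;
         0, 1, 0, 0;
         0, 0, 0, 0;
         0, 0, 1, 0;
         0, 0, 0, 0;
         0, 0, 0, 1] := by
  refine ⟨by decide, by decide, fun w => ?_⟩
  obtain ⟨a, b, c, d, e, f, g, h, rfl⟩ := exists_eq_vecCons w
  simp [Orthogonal, rootForm_apply, highestRootE8, highestRootE7, highestRootD6, highestRootD4,
    funext_iff, Fin.forall_fin_succ]
  omega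

theorem hasBasis_antiFixed_four' :
    HasBasis (AntiFixed ![highestRootE8, highestRootE7, highestRootD6, highestRootD4]) (A1pow 4)
      !![2, 3, 4, 5, 6, 4, 2, 3;
         0, 1, 2, 3, 4, 3, 2, 2;
         0, 1, 2, 2, 2, 1, 0, 1;
         0, 0, 0, 1, 2, 1, 0, 1]
      !![0, -1, -1, 0;
         1, 1, 1, 0;
         0, 0, 0, 0;
         -1, -1, 0, -1;
         0, 0, 0, 0;
         0, 1, -1, -1;
         0, 0, 0, 0;
         1, 0, 1, 3] := by
  refine ⟨by decide, by decide, fun w => ?_⟩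
  obtain ⟨a, b, c, d, e, f, g, h, rfl⟩ := exists_eq_vecCons w
  simp [AntiFixed, rootForm_apply, highestRootE8, highestRootE7, highestRootD6, highestRootD4,
    funext_iff, Fin.forall_fin_succ, Fin.sum_univ_succ]
  omega

/-- `θ` is the product of the reflections in the orthogonal roots `r i`. -/
def IsReflectionProduct {k : ℕ} (r : Fin k → Fin 8 → ℤ) (θ : (Fin 8 → ℤ) →ₗ[ℤ] (Fin 8 → ℤ)) :
    Prop :=
  ∀ x, θ x = x - ∑ i, rootForm (r i) x • r i

/-- The conjugacy class of an involution, given by a frame of at most four orthogonal roots in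
normal form, determines the fixed and anti-fixed lattices. -/
theorem IsReflectionProduct.isoHalf {k : ℕ} {r h : Fin k → Fin 8 → ℤ} (hr : IsRootFrame r)
    {θ : (Fin 8 → ℤ) →ₗ[ℤ] (Fin 8 → ℤ)} (hθ : IsReflectionProduct r θ)
    {g : (Fin 8 → ℤ) ≃ₗ[ℤ] (Fin 8 → ℤ)} (hg : IsIsometry g) (hgr : ∀ i, g (r i) = h i)
    {m n : ℕ} {G : Matrix (Fin m) (Fin m) ℤ} {M : Matrix (Fin m) (Fin 8) ℤ}
    {N : Matrix (Fin 8) (Fin m) ℤ} (hG : HasBasis (Orthogonal h) G M N)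
    {G' : Matrix (Fin n) (Fin n) ℤ} {M' : Matrix (Fin n) (Fin 8) ℤ}
    {N' : Matrix (Fin 8) (Fin n) ℤ} (hG' : HasBasis (AntiFixed h) G' M' N')
    {Sp Sm : Submodule ℤ (Fin 8 → ℤ)} (hSp : ∀ x, x ∈ Sp ↔ θ x = x)
    (hSm : ∀ x, x ∈ Sm ↔ θ x = -x) : IsoHalf Sp G ∧ IsoHalf Sm G' := by
  have hform : ∀ i x, rootForm (h i) (g x) = rootForm (r i) x := fun i x => by rw [← hgr, hg]
  refine ⟨hG.isoHalf hg fun x => ?_, hG'.isoHalf hg fun x => ?_⟩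
  · rw [hSp, hθ, sub_eq_self]
    simp only [Orthogonal, hform]
    refine ⟨fun hx i => ?_, fun hx => by simp [hx]⟩
    have := congrArg (rootForm (r i)) hx
    simp only [map_sum, map_smul, hr i, smul_eq_mul, map_zero] at this
    simpa using this
  · have hsum : g (∑ i, rootForm (r i) x • r i) = ∑ i, rootForm (h i) (g x) • h i := by
      simp only [map_sum, map_smul, hgr, hform]
    rw [hSm, hθ, AntiFixed, ← hsum, ← map_smul, g.injective.eq_iff, two_smul,
      sub_eq_iff_eq_add', ← sub_eq_add_neg, eq_sub_iff_add_eq]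

theorem isoHalf_of_frame_lt_five {k : ℕ} (hk : k < 5) {r : Fin k → Fin 8 → ℤ} (hr : IsRootFrame r)
    {θ : (Fin 8 → ℤ) →ₗ[ℤ] (Fin 8 → ℤ)} (hθ : IsReflectionProduct r θ)
    {Sp Sm : Submodule ℤ (Fin 8 → ℤ)} (hSp : ∀ x, x ∈ Sp ↔ θ x = x)
    (hSm : ∀ x, x ∈ Sm ↔ θ x = -x) :
    (IsoHalf Sp E8G ∧ IsoHalf Sm (A1pow 0)) ∨ (IsoHalf Sp E7G ∧ IsoHalf Sm (A1pow 1)) ∨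
    (IsoHalf Sp D6G ∧ IsoHalf Sm (A1pow 2)) ∨ (IsoHalf Sp D4A1G ∧ IsoHalf Sm (A1pow 3)) ∨
    (IsoHalf Sp D4G ∧ IsoHalf Sm D4G) ∨ (IsoHalf Sp (A1pow 4) ∧ IsoHalf Sm (A1pow 4)) := by
  interval_cases k
  · exact Or.inl (hθ.isoHalf hr IsIsometry.refl (fun _ => rfl) (hasBasis_orthogonal_zero r)
      (hasBasis_antiFixed_zero r) hSp hSm)
  · obtain ⟨g, hg, h0⟩ := exists_isometry_highestRootE8 (hr 0 0)
    refine Or.inr (Or.inl (hθ.isoHalf hr hg (fun i => ?_) hasBasis_orthogonal_one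
      hasBasis_antiFixed_one hSp hSm))
    fin_cases i; exact h0
  · have hr' : IsRootFrame ![r 0, r 1] := by
      convert hr using 1; ext i; fin_cases i <;> rfl
    obtain ⟨g, hg, h0, h1⟩ := exists_isometry_highestRootE7 hr'
    refine Or.inr (Or.inr (Or.inl (hθ.isoHalf hr hg (fun i => ?_) hasBasis_orthogonal_two
      hasBasis_antiFixed_two hSp hSm)))
    fin_cases i; exacts [h0, h1]
  · have hr' : IsRootFrame ![r 0, r 1, r 2] := by
      convert hr using 1; ext i; fin_cases i <;> rfl
    obtain ⟨g, hg, h0, h1, h2⟩ := exists_isometry_highestRootD6 hr'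
    refine Or.inr (Or.inr (Or.inr (Or.inl (hθ.isoHalf hr hg (fun i => ?_)
      hasBasis_orthogonal_three hasBasis_antiFixed_three hSp hSm))))
    fin_cases i; exacts [h0, h1, h2]
  · have hr' : IsRootFrame ![r 0, r 1, r 2, r 3] := by
      convert hr using 1; ext i; fin_cases i <;> rfl
    obtain ⟨g, hg, h0, h1, h2, h3 | h3⟩ := exists_isometry_frame_four hr'
    · refine Or.inr (Or.inr (Or.inr (Or.inr (Or.inl (hθ.isoHalf hr hg (fun i => ?_)
        hasBasis_orthogonal_four hasBasis_antiFixed_four hSp hSm)))))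
      fin_cases i; exacts [h0, h1, h2, h3]
    · refine Or.inr (Or.inr (Or.inr (Or.inr (Or.inr (hθ.isoHalf hr hg (fun i => ?_)
        hasBasis_orthogonal_four' hasBasis_antiFixed_four' hSp hSm)))))
      fin_cases i; exacts [h0, h1, h2, h3]

theorem IsRootFrame.append {k l : ℕ} {r : Fin k → Fin 8 → ℤ} {s : Fin l → Fin 8 → ℤ}
    (hr : IsRootFrame r) (hs : IsRootFrame s) (hrs : ∀ i j, rootForm (r i) (s j) = 0) :
    IsRootFrame (Fin.append r s) := by
  intro i j
  refine Fin.addCases (fun i => ?_) (fun i => ?_) i <;>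
    refine Fin.addCases (fun j => ?_) (fun j => ?_) j
  · simpa using hr i j
  · have hij : Fin.castAdd l i ≠ Fin.natAdd k j := fun h => by simp [Fin.ext_iff] at h; omega
    simpa [hij] using hrs i j
  · have hij : Fin.natAdd k i ≠ Fin.castAdd l j := fun h => by simp [Fin.ext_iff] at h; omega
    simpa [hij, rootForm_comm (s i)] using hrs j i
  · simpa using hs i j

theorem not_isRootFrame_five_five {θ : (Fin 8 → ℤ) →ₗ[ℤ] (Fin 8 → ℤ)}
    (hisom : ∀ x y, rootForm (θ x) (θ y) = rootForm x y) {r s : Fin 5 → Fin 8 → ℤ}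
    (hr : IsRootFrame r) (hs : IsRootFrame s) (hθr : ∀ i, θ (r i) = -r i) :
    ¬ ∀ i, θ (s i) = s i := by
  intro hθs
  have := (hr.append hs fun i j => by
    have := hisom (r i) (s j)
    rw [hθr, hθs, map_neg, LinearMap.neg_apply] at this
    omega).card_le
  omega

/-- Lemma 5.1: For any involution `θ` of `S = E₈(2)`, the pair
`(S₊(1/2), S₋(1/2))` of fixed and anti-fixed sublattices (with the form halved)
is isomorphic to one of the ten listed pairs. -/
theorem stmt_11 (θ : (Fin 8 → ℤ) ≃ₗ[ℤ] (Fin 8 → ℤ))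
    (hisom : ∀ x y, B8 (θ x) (θ y) = B8 x y)
    (hinv : ∀ x, θ (θ x) = x)
    (Sp Sm : Submodule ℤ (Fin 8 → ℤ))
    (hSp : ∀ x, x ∈ Sp ↔ θ x = x)
    (hSm : ∀ x, x ∈ Sm ↔ θ x = -x) :
    (IsoHalf Sp E8G ∧ IsoHalf Sm (A1pow 0)) ∨
    (IsoHalf Sp E7G ∧ IsoHalf Sm (A1pow 1)) ∨
    (IsoHalf Sp D6G ∧ IsoHalf Sm (A1pow 2)) ∨
    (IsoHalf Sp D4A1G ∧ IsoHalf Sm (A1pow 3)) ∨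
    (IsoHalf Sp D4G ∧ IsoHalf Sm D4G) ∨
    (IsoHalf Sp (A1pow 4) ∧ IsoHalf Sm (A1pow 4)) ∨
    (IsoHalf Sp (A1pow 3) ∧ IsoHalf Sm D4A1G) ∨
    (IsoHalf Sp (A1pow 2) ∧ IsoHalf Sm D6G) ∨
    (IsoHalf Sp (A1pow 1) ∧ IsoHalf Sm E7G) ∨
    (IsoHalf Sp (A1pow 0) ∧ IsoHalf Sm E8G) := by
  have hisom' : ∀ x y, rootForm (θ x) (θ y) = rootForm x y := fun x y => by
    have := hisom x y
    rw [B8_eq_rootForm, B8_eq_rootForm] at this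
    omega
  rcases exists_rootFrame 5 θ.toLinearMap hisom' hinv with ⟨k, hk, r, hr, hθ⟩ | ⟨r, hr, hθr⟩
  · rcases isoHalf_of_frame_lt_five hk hr hθ hSp hSm with h | h | h | h | h | h <;>
      simp only [h, and_self, true_or, or_true]
  rcases exists_rootFrame 5 (-θ.toLinearMap) (fun x y => by simpa using hisom' x y)
    (fun x => by simpa using hinv x) with ⟨k, hk, s, hs, hθ⟩ | ⟨s, hs, hθs⟩
  · rcases isoHalf_of_frame_lt_five hk hs hθ (Sp := Sm) (Sm := Sp)
      (fun x => by rw [hSm]; exact neg_eq_iff_eq_neg.symm)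
      (fun x => by rw [hSp]; exact neg_inj.symm) with h | h | h | h | h | h <;>
      simp only [h, and_self, true_or, or_true]
  · exact absurd (fun i => neg_inj.1 (hθs i)) (not_isRootFrame_five_five hisom' hr hs hθr)
end

section
/- Every primitive sublattice of the even unimodular lattice U ⊕ E₈ of signature (1,9) isomorphic to one of 0, A₁, A₁², A₁³, A₁⁴, D₄, D₄⊕A₁, D₆, E₇, E₈ is unique up to isometry of U ⊕ E₈; i.e., any two primitive embeddings of such a lattice into U ⊕ E₈ differ by an isometry of U ⊕ E₈. -/
open Matrix

/-- Gram matrix of the hyperbolic plane `U`. -/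
def UG : Matrix (Fin 2) (Fin 2) ℤ := !![0, 1; 1, 0]

/-- Gram matrix of the even unimodular lattice `U ⊕ E₈` of signature `(1,9)`. -/
def Gram10 : Matrix (Fin 2 ⊕ Fin 8) (Fin 2 ⊕ Fin 8) ℤ :=
  Matrix.fromBlocks UG 0 0 E8G

/-- The bilinear form of `U ⊕ E₈`. -/
def B10 (x y : (Fin 2 ⊕ Fin 8) → ℤ) : ℤ := x ⬝ᵥ Gram10.mulVec y

/-- The lattice `(S, BS)` is isometric to the lattice with Gram matrix `G`. -/
def IsoToGram (S : Type) [AddCommGroup S] [Module ℤ S]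
    (BS : S →ₗ[ℤ] S →ₗ[ℤ] ℤ) {m : ℕ} (G : Matrix (Fin m) (Fin m) ℤ) : Prop :=
  ∃ e : S ≃ₗ[ℤ] (Fin m → ℤ), ∀ x y, BS x y = (e x) ⬝ᵥ G.mulVec (e y)

/-- The isometries of a bilinear form on a `ℤ`-module. -/
def isometryGroup {M : Type*} [AddCommGroup M] (B : LinearMap.BilinForm ℤ M) :
    Subgroup (M ≃ₗ[ℤ] M) where
  carrier := {g | ∀ x y, B (g x) (g y) = B x y}
  one_mem' _ _ := rfl
  mul_mem' {g h} hg hh x y := (hg (h x) (h y)).trans (hh x y)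
  inv_mem' {g} hg x y := by
    have h := hg (g.symm x) (g.symm y)
    simp only [LinearEquiv.apply_symm_apply] at h
    exact h.symm

namespace E10

/-- Gram matrix of the simple roots of `E₁₀ = T₂,₃,₇`: the nodes `0, …, 8` form a chain and `9`
is attached to `6`. -/
def cartan : Matrix (Fin 10) (Fin 10) ℤ :=
  !![-2,  1,  0,  0,  0,  0,  0,  0,  0,  0;
      1, -2,  1,  0,  0,  0,  0,  0,  0,  0;
      0,  1, -2,  1,  0,  0,  0,  0,  0,  0;
      0,  0,  1, -2,  1,  0,  0,  0,  0,  0;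
      0,  0,  0,  1, -2,  1,  0,  0,  0,  0;
      0,  0,  0,  0,  1, -2,  1,  0,  0,  0;
      0,  0,  0,  0,  0,  1, -2,  1,  0,  1;
      0,  0,  0,  0,  0,  0,  1, -2,  1,  0;
      0,  0,  0,  0,  0,  0,  0,  1, -2,  0;
      0,  0,  0,  0,  0,  0,  1,  0,  0, -2]

/-- The inverse of `cartan`; its columns are the fundamental weights. -/
def weight : Matrix (Fin 10) (Fin 10) ℤ :=
  !![0,  1,  2,  3,  4,  5,  6,  4,  2,  3;
     1,  2,  4,  6,  8, 10, 12,  8,  4,  6;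
     2,  4,  6,  9, 12, 15, 18, 12,  6,  9;
     3,  6,  9, 12, 16, 20, 24, 16,  8, 12;
     4,  8, 12, 16, 20, 25, 30, 20, 10, 15;
     5, 10, 15, 20, 25, 30, 36, 24, 12, 18;
     6, 12, 18, 24, 30, 36, 42, 28, 14, 21;
     4,  8, 12, 16, 20, 24, 28, 18,  9, 14;
     2,  4,  6,  8, 10, 12, 14,  9,  4,  7;
     3,  6,  9, 12, 15, 18, 21, 14,  7, 10]

/-- The bilinear form of the `E₁₀` root lattice, in coordinates with respect to simple roots. -/
def form : LinearMap.BilinForm ℤ (Fin 10 → ℤ) := Matrix.toBilin' cartan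

/-- The simple roots. -/
def simpleRoot (i : Fin 10) : Fin 10 → ℤ := Pi.single i 1

theorem form_apply (x y : Fin 10 → ℤ) :
    form x y = -2 * (x 0 * y 0 + x 1 * y 1 + x 2 * y 2 + x 3 * y 3 + x 4 * y 4 + x 5 * y 5
      + x 6 * y 6 + x 7 * y 7 + x 8 * y 8 + x 9 * y 9)
      + (x 0 * y 1 + x 1 * y 0) + (x 1 * y 2 + x 2 * y 1) + (x 2 * y 3 + x 3 * y 2)
      + (x 3 * y 4 + x 4 * y 3) + (x 4 * y 5 + x 5 * y 4) + (x 5 * y 6 + x 6 * y 5)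
      + (x 6 * y 7 + x 7 * y 6) + (x 7 * y 8 + x 8 * y 7) + (x 6 * y 9 + x 9 * y 6) := by
  simp [form, Matrix.toBilin'_apply', cartan, Fin.sum_univ_succ, dotProduct, Matrix.mulVec]
  ring

theorem form_comm (x y : Fin 10 → ℤ) : form x y = form y x := by
  rw [form_apply, form_apply]; ring

theorem form_simpleRoot (i j : Fin 10) : form (simpleRoot i) (simpleRoot j) = cartan i j := by
  simp [form, simpleRoot]

theorem form_simpleRoot_self (i : Fin 10) : form (simpleRoot i) (simpleRoot i) = -2 := by
  rw [form_simpleRoot]; revert i; decide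

theorem form_simpleRoot_right (x : Fin 10 → ℤ) (i : Fin 10) :
    form x (simpleRoot i) = ∑ k, x k * cartan k i := by
  simp [form, simpleRoot, Matrix.toBilin'_apply', dotProduct]

theorem eq_sum_simpleRoot (x : Fin 10 → ℤ) : x = ∑ i, x i • simpleRoot i := by
  simpa [simpleRoot] using pi_eq_sum_univ' x

theorem form_eq_sum (x y : Fin 10 → ℤ) : form x y = ∑ i, y i * form x (simpleRoot i) := by
  conv_lhs => rw [eq_sum_simpleRoot y]
  simp only [map_sum, map_smul, smul_eq_mul]

theorem form_even (x : Fin 10 → ℤ) : Even (form x x) := by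
  rw [form_apply, even_iff_two_dvd]
  exact ⟨-(x 0 ^ 2 + x 1 ^ 2 + x 2 ^ 2 + x 3 ^ 2 + x 4 ^ 2 + x 5 ^ 2 + x 6 ^ 2 + x 7 ^ 2 + x 8 ^ 2
    + x 9 ^ 2) + x 0 * x 1 + x 1 * x 2 + x 2 * x 3 + x 3 * x 4 + x 4 * x 5 + x 5 * x 6 + x 6 * x 7
    + x 7 * x 8 + x 6 * x 9, by ring⟩

/-- The form is nondegenerate. -/
theorem eq_zero_of_form_eq_zero {x : Fin 10 → ℤ} (h : ∀ i, form x (simpleRoot i) = 0) : x = 0 := by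
  have h1 : x ᵥ* cartan = 0 := by
    ext i
    rw [Matrix.vecMul, dotProduct, ← form_simpleRoot_right, h, Pi.zero_apply]
  have h2 : cartan * weight = 1 := by decide
  rw [← Matrix.vecMul_one x, ← h2, ← Matrix.vecMul_vecMul, h1, Matrix.zero_vecMul]

/-- The parabolic estimate coming from the affine subdiagram `E₉`. -/
theorem form_self_le (x : Fin 10 → ℤ) : form x x ≤ 2 * x 0 * (x 1 - x 0) := by
  rw [form_apply]
  nlinarith [sq_nonneg (2 * x 9 - x 6), sq_nonneg (2 * x 8 - x 7), sq_nonneg (3 * x 7 - 2 * x 6),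
    sq_nonneg (5 * x 6 - 6 * x 5), sq_nonneg (4 * x 5 - 5 * x 4), sq_nonneg (3 * x 4 - 4 * x 3),
    sq_nonneg (2 * x 3 - 3 * x 2), sq_nonneg (x 2 - 2 * x 1)]

theorem form_self_nonpos {x : Fin 10 → ℤ} (h : x 0 = 0) : form x x ≤ 0 := by
  simpa [h] using form_self_le x

theorem form_mul_eq (r t : Fin 10 → ℚ) :
    -2 * ((r 0 * t 0) * (r 0 * t 0) + (r 1 * t 1) * (r 1 * t 1) + (r 2 * t 2) * (r 2 * t 2)
      + (r 3 * t 3) * (r 3 * t 3) + (r 4 * t 4) * (r 4 * t 4) + (r 5 * t 5) * (r 5 * t 5)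
      + (r 6 * t 6) * (r 6 * t 6) + (r 7 * t 7) * (r 7 * t 7) + (r 8 * t 8) * (r 8 * t 8)
      + (r 9 * t 9) * (r 9 * t 9)) + 2 * (r 0 * t 0) * (r 1 * t 1) + 2 * (r 1 * t 1) * (r 2 * t 2)
      + 2 * (r 2 * t 2) * (r 3 * t 3) + 2 * (r 3 * t 3) * (r 4 * t 4)
      + 2 * (r 4 * t 4) * (r 5 * t 5) + 2 * (r 5 * t 5) * (r 6 * t 6)
      + 2 * (r 6 * t 6) * (r 7 * t 7) + 2 * (r 7 * t 7) * (r 8 * t 8)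
      + 2 * (r 6 * t 6) * (r 9 * t 9) =
    ∑ i, r i * t i ^ 2 * ∑ k, r k * cartan k i
      - (r 0 * r 1 * (t 0 - t 1) ^ 2 + r 1 * r 2 * (t 1 - t 2) ^ 2 + r 2 * r 3 * (t 2 - t 3) ^ 2
        + r 3 * r 4 * (t 3 - t 4) ^ 2 + r 4 * r 5 * (t 4 - t 5) ^ 2 + r 5 * r 6 * (t 5 - t 6) ^ 2
        + r 6 * r 7 * (t 6 - t 7) ^ 2 + r 7 * r 8 * (t 7 - t 8) ^ 2
        + r 6 * r 9 * (t 6 - t 9) ^ 2) := by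
  simp [Fin.sum_univ_succ, cartan]
  ring

/-- Removing a node other than `0` from the diagram leaves a negative definite lattice. -/
theorem form_self_neg {x : Fin 10 → ℤ} {i : Fin 10} (hi : i ≠ 0) (hxi : x i = 0) (hx : x ≠ 0) :
    form x x < 0 := by
  by_contra! hle
  obtain ⟨r, hr⟩ : ∃ r : Fin 10 → ℚ, r = fun k => (weight i k : ℚ) := ⟨_, rfl⟩
  have hpos : ∀ k, 0 < r k := by
    intro k
    have h : ∀ p : Fin 10 × Fin 10, p.1 ≠ 0 → 0 < weight p.1 p.2 := by
      decide +kernel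
    simp only [hr]
    exact_mod_cast h (i, k) hi
  have hdual : ∀ j, ∑ k, r k * cartan k j = if j = i then 1 else 0 := by
    intro j
    have : weight * cartan = 1 := by decide
    have := congrFun (congrFun this i) j
    rw [Matrix.mul_apply, Matrix.one_apply] at this
    rw [hr]
    simp only [eq_comm (a := j)]
    exact_mod_cast this
  obtain ⟨t, ht⟩ : ∃ t : Fin 10 → ℚ, ∀ k, (x k : ℚ) = r k * t k :=
    ⟨fun k => x k / r k, fun k => (mul_div_cancel₀ _ (hpos k).ne').symm⟩
  have hti : t i = 0 := by
    have := ht i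
    rw [hxi] at this
    simpa [(hpos i).ne'] using this.symm
  have key := form_mul_eq r t
  simp only [hdual, mul_ite, mul_one, mul_zero, Finset.sum_ite_eq', Finset.mem_univ, if_true, hti,
    ← ht] at key
  have hle' : (0 : ℚ) ≤ form x x := by exact_mod_cast hle
  rw [form_apply] at hle'
  push_cast at hle'
  have hsq : ∀ j k, 0 ≤ r j * r k * (t j - t k) ^ 2 := fun j k =>
    mul_nonneg (mul_pos (hpos j) (hpos k)).le (sq_nonneg _)
  have edge : ∀ j k, r j * r k * (t j - t k) ^ 2 ≤ 0 → t j = t k := by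
    intro j k h
    have := (mul_eq_zero.1 (le_antisymm h (hsq j k))).resolve_left
      (mul_pos (hpos j) (hpos k)).ne'
    exact sub_eq_zero.1 (pow_eq_zero_iff two_ne_zero |>.1 this)
  have h01 := hsq 0 1
  have h12 := hsq 1 2
  have h23 := hsq 2 3
  have h34 := hsq 3 4
  have h45 := hsq 4 5
  have h56 := hsq 5 6
  have h67 := hsq 6 7
  have h78 := hsq 7 8
  have h69 := hsq 6 9
  have e01 := edge 0 1 (by linarith)
  have e12 := edge 1 2 (by linarith)
  have e23 := edge 2 3 (by linarith)
  have e34 := edge 3 4 (by linarith)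
  have e45 := edge 4 5 (by linarith)
  have e56 := edge 5 6 (by linarith)
  have e67 := edge 6 7 (by linarith)
  have e78 := edge 7 8 (by linarith)
  have e69 := edge 6 9 (by linarith)
  have hconst : ∀ k, t k = t 6 := by
    intro k
    fin_cases k <;> simp [e01, e12, e23, e34, e45, e56, ← e67, ← e78, ← e69]
  refine hx (funext fun k => ?_)
  have := ht k
  rw [hconst k, ← hconst i, hti, mul_zero] at this
  exact_mod_cast this

theorem form_self_le_neg_two {x : Fin 10 → ℤ} {i : Fin 10} (hi : i ≠ 0) (hxi : x i = 0)
    (hx : x ≠ 0) : form x x ≤ -2 := by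
  have h := form_self_neg hi hxi hx
  obtain ⟨a, ha⟩ := form_even x
  omega

theorem not_neg_pos_of_root {x : Fin 10 → ℤ} (hx : form x x = -2) {i k : Fin 10}
    (hk0 : k ≠ 0) (hi : x i < 0) (hk : 0 < x k) : False := by
  obtain ⟨y, hy⟩ : ∃ y : Fin 10 → ℤ, ∀ j, y j = max (x j) 0 := ⟨_, fun _ => rfl⟩
  obtain ⟨z, hz⟩ : ∃ z : Fin 10 → ℤ, ∀ j, z j = max (-x j) 0 := ⟨_, fun _ => rfl⟩
  have hy0 : ∀ j, 0 ≤ y j := fun j => by rw [hy]; exact le_max_right _ _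
  have hz0 : ∀ j, 0 ≤ z j := fun j => by rw [hz]; exact le_max_right _ _
  have hyz : ∀ j, y j * z j = 0 := fun j => by
    rw [hy, hz]
    rcases le_total 0 (x j) with h | h
    · rw [max_eq_right (neg_nonpos.2 h), mul_zero]
    · rw [max_eq_right h, zero_mul]
  have hxyz : x = y - z := funext fun j => by
    rw [Pi.sub_apply, hy, hz]; omega
  have hyi : y i = 0 := by rw [hy, max_eq_right hi.le]
  have hzi : 0 < z i := by rw [hz]; omega
  have hyk : 0 < y k := by rw [hy]; omega
  have hzk : z k = 0 := by rw [hz]; omega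
  have hyne : y ≠ 0 := fun h => hyk.ne' (by rw [h]; rfl)
  have hzne : z ≠ 0 := fun h => hzi.ne' (by rw [h]; rfl)
  have hcross : y 1 * z 0 ≤ form y z := by
    have h : ∀ a b, 0 ≤ y a * z b := fun a b => mul_nonneg (hy0 a) (hz0 b)
    rw [form_apply]
    simp only [hyz]
    linarith [h 0 1, h 1 2, h 2 1, h 2 3, h 3 2, h 3 4, h 4 3, h 4 5, h 5 4, h 5 6, h 6 5,
      h 6 7, h 7 6, h 7 8, h 8 7, h 6 9, h 9 6]
  have hcross0 : 0 ≤ y 1 * z 0 := mul_nonneg (hy0 1) (hz0 0)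
  have hexp : form x x = form y y + form z z - 2 * form y z := by
    rw [hxyz]
    simp only [map_sub, LinearMap.sub_apply, form_comm z y]
    ring
  have hz2 := form_self_le_neg_two hk0 hzk hzne
  by_cases hi0 : i = 0
  · subst hi0
    have hyy := form_self_nonpos hyi
    have hyy0 : ¬ form y y < 0 := fun h => by omega
    have hy1 : y 1 ≠ 0 := fun h => hyy0 (form_self_neg one_ne_zero h hyne)
    have : 0 < y 1 * z 0 := mul_pos (lt_of_le_of_ne (hy0 1) hy1.symm) hzi
    omega
  · have := form_self_le_neg_two hi0 hyi hyne
    omega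

/-- Every root is either positive or negative. -/
theorem root_nonneg_or_nonpos {x : Fin 10 → ℤ} (hx : form x x = -2) :
    (∀ i, 0 ≤ x i) ∨ ∀ i, x i ≤ 0 := by
  by_contra! h
  obtain ⟨⟨i, hi⟩, k, hk⟩ := h
  by_cases hk0 : k = 0
  · have hi0 : i ≠ 0 := by rintro rfl; subst hk0; omega
    refine not_neg_pos_of_root (x := -x) (i := k) (k := i) ?_ hi0 ?_ ?_
    · simpa using hx
    · simpa using hk
    · simpa using hi
  · exact not_neg_pos_of_root hx hk0 hi hk

/-- The reflection in a root. -/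
def reflection (γ : Fin 10 → ℤ) (hγ : form γ γ = -2) : (Fin 10 → ℤ) ≃ₗ[ℤ] (Fin 10 → ℤ) :=
  LinearEquiv.ofInvolutive (LinearMap.id + (form γ).smulRight γ) fun x => by
    simp only [LinearMap.add_apply, LinearMap.id_apply, LinearMap.smulRight_apply, map_add,
      map_smul, hγ]
    module

theorem reflection_apply (γ : Fin 10 → ℤ) (hγ : form γ γ = -2) (x : Fin 10 → ℤ) :
    reflection γ hγ x = x + form γ x • γ := rfl

theorem reflection_mem (γ : Fin 10 → ℤ) (hγ : form γ γ = -2) :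
    reflection γ hγ ∈ isometryGroup form := fun x y => by
  simp only [reflection_apply, map_add, map_smul, LinearMap.add_apply, LinearMap.smul_apply,
    smul_eq_mul, hγ, form_comm x γ]
  ring

/-- The positive cone. -/
def IsPositive (x : Fin 10 → ℤ) : Prop := 0 < form x x ∧ 0 < x 0

theorem IsPositive.sum_pos {x : Fin 10 → ℤ} (hx : IsPositive x) : 0 < ∑ i, x i := by
  obtain ⟨ρ, hρ⟩ : ∃ ρ : Fin 10 → ℤ, ρ = ![30, 61, 93, 126, 160, 195, 231, 153, 76, 115] := ⟨_, rfl⟩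
  have h1 : form x ρ = ∑ i, x i := by
    rw [form_apply, hρ]
    simp [Fin.sum_univ_succ]
    ring
  have h2 : form ρ ρ = 1240 := by
    rw [form_apply, hρ]
    simp
  have h3 : form ((30 : ℤ) • x - x 0 • ρ) ((30 : ℤ) • x - x 0 • ρ) ≤ 0 :=
    form_self_nonpos (by simp [hρ]; ring)
  simp only [map_sub, LinearMap.sub_apply, map_smul, LinearMap.smul_apply, smul_eq_mul,
    form_comm ρ x, h1, h2] at h3
  obtain ⟨hx1, hx2⟩ := hx
  by_contra! hle
  nlinarith [mul_nonneg hx2.le (neg_nonneg.2 hle), mul_pos hx2 hx2]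

theorem IsPositive.reflection {x : Fin 10 → ℤ} (hx : IsPositive x) (i : Fin 10) :
    IsPositive (reflection (simpleRoot i) (form_simpleRoot_self i) x) := by
  refine ⟨by rw [reflection_mem]; exact hx.1, ?_⟩
  rw [reflection_apply, Pi.add_apply, Pi.smul_apply, smul_eq_mul]
  by_cases hi : i = 0
  · subst hi
    have h1 := form_self_le x
    have h2 : form (simpleRoot 0) x = -2 * x 0 + x 1 := by
      rw [form_apply]; simp [simpleRoot]
    have h3 : simpleRoot 0 0 = 1 := by simp [simpleRoot]
    rw [h2, h3]
    have := hx.1.trans_le h1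
    have := pos_of_mul_pos_right this (mul_pos two_pos hx.2).le
    omega
  · have : simpleRoot i 0 = 0 := by simp [simpleRoot, Ne.symm hi]
    rw [this, mul_zero, add_zero]
    exact hx.2

/-- Every vector of the positive cone can be moved into the chamber of a parabolic subgroup by an
element of this subgroup. -/
theorem IsPositive.exists_isometry_nonneg (J : Finset (Fin 10)) {x : Fin 10 → ℤ}
    (hx : IsPositive x) :
    ∃ g ∈ isometryGroup form, IsPositive (g x) ∧
      (∀ y, (∀ j ∈ J, form y (simpleRoot j) = 0) → g y = y) ∧
      ∀ j ∈ J, 0 ≤ form (g x) (simpleRoot j) := by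
  induction hn : (∑ i, x i).toNat using Nat.strong_induction_on generalizing x with
  | _ n ih =>
    by_cases h : ∀ j ∈ J, 0 ≤ form x (simpleRoot j)
    · exact ⟨1, one_mem _, hx, fun _ _ => rfl, h⟩
    push Not at h
    obtain ⟨j, hj, hneg⟩ := h
    obtain ⟨s, hs⟩ : ∃ s, s = E10.reflection (simpleRoot j) (form_simpleRoot_self j) := ⟨_, rfl⟩
    have hsx : IsPositive (s x) := hs ▸ hx.reflection j
    have hsum : ∑ i, (s x) i = ∑ i, x i + form x (simpleRoot j) := by
      rw [hs, reflection_apply, form_comm]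
      simp [Finset.sum_add_distrib, simpleRoot, Pi.single_apply]
    have hpos := hsx.sum_pos
    obtain ⟨g, hg, hgx, hfix, hJ⟩ := ih _ (by omega) hsx rfl
    refine ⟨g * s, mul_mem hg (hs ▸ reflection_mem _ _), hgx, fun y hy => ?_, hJ⟩
    have : s y = y := by
      rw [hs, reflection_apply, form_comm, hy j hj, zero_smul, add_zero]
    rw [LinearEquiv.mul_apply, this, hfix y hy]

theorem IsPositive.exists_add {v : Fin 10 → ℤ} (hv : IsPositive v) (u : Fin 10 → ℤ) :
    ∃ N : ℤ, ∀ m ≥ N, IsPositive (u + m • v) := by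
  refine ⟨|form u u| + 2 * |form u v| + |u 0| + 1, fun m hm => ?_⟩
  obtain ⟨hv1, hv2⟩ := hv
  have h1 := abs_nonneg (form u u)
  have h2 := abs_nonneg (form u v)
  have h3 := abs_nonneg (u 0)
  constructor
  · simp only [map_add, map_smul, LinearMap.add_apply, LinearMap.smul_apply, smul_eq_mul,
      form_comm v u]
    have h4 := neg_abs_le (form u u)
    have h5 := neg_abs_le (form u v)
    nlinarith [mul_nonneg (show 0 ≤ m by omega) (show 0 ≤ form v v - 1 by omega),
      mul_nonneg (show 0 ≤ m by omega) (show 0 ≤ form u v + |form u v| by omega),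
      mul_nonneg (show 0 ≤ m by omega) (mul_nonneg (show 0 ≤ m by omega)
      (show 0 ≤ form v v - 1 by omega)),
      mul_nonneg (show 0 ≤ m - 1 by omega)
      (show 0 ≤ m - (|form u u| + 2 * |form u v| + |u 0| + 1) by omega),
      mul_nonneg (show 0 ≤ m by omega) h1,
      mul_nonneg (show 0 ≤ m by omega) h2, mul_nonneg (show 0 ≤ m by omega) h3,
      mul_nonneg (show 0 ≤ m - 1 by omega) h1]
  · rw [Pi.add_apply, Pi.smul_apply, smul_eq_mul]
    have h4 := neg_abs_le (u 0)
    nlinarith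

/-- The family `β` generates a primitive sublattice, and its Gram matrix is that of the simple
roots `τ`, which do not involve the node `1`. -/
structure IsRootSystemBasis {ι : Type*} (τ : ι → Fin 10) (β : ι → Fin 10 → ℤ) : Prop where
  injective : Function.Injective τ
  ne_one : ∀ j, τ j ≠ 1
  gram : ∀ j k, form (β j) (β k) = cartan (τ j) (τ k)
  primitive : ∀ (n : ℤ) (x : Fin 10 → ℤ), n ≠ 0 → n • x ∈ Submodule.span ℤ (Set.range β) →
    x ∈ Submodule.span ℤ (Set.range β)

namespace IsRootSystemBasis

variable {ι : Type*} {τ : ι → Fin 10} {β : ι → Fin 10 → ℤ}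

theorem map (hβ : IsRootSystemBasis τ β) {g : (Fin 10 → ℤ) ≃ₗ[ℤ] (Fin 10 → ℤ)}
    (hg : g ∈ isometryGroup form) : IsRootSystemBasis τ (g ∘ β) where
  injective := hβ.injective
  ne_one := hβ.ne_one
  gram j k := (hg _ _).trans (hβ.gram j k)
  primitive n x hn hx := by
    have hspan : Submodule.span ℤ (Set.range (g ∘ β)) =
        (Submodule.span ℤ (Set.range β)).map g.toLinearMap := by
      rw [Submodule.map_span, Set.range_comp]; rfl
    rw [hspan, Submodule.mem_map] at hx ⊢
    obtain ⟨y, hy, hyx⟩ := hx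
    refine ⟨g.symm x, hβ.primitive n _ hn ?_, g.apply_symm_apply x⟩
    rwa [← map_smul, ← hyx, LinearEquiv.coe_coe, LinearEquiv.symm_apply_apply]

theorem form_eq_zero_of_mem {u s : Fin 10 → ℤ} (hu : ∀ j, form u (β j) = 0)
    (hs : s ∈ Submodule.span ℤ (Set.range β)) : form u s = 0 := by
  have : Submodule.span ℤ (Set.range β) ≤ LinearMap.ker (form u) :=
    Submodule.span_le.2 (Set.range_subset_iff.2 hu)
  exact this hs

variable [Fintype ι]

theorem form_sum (hβ : IsRootSystemBasis τ β) (c : ι → ℤ) :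
    form (∑ j, c j • β j) (∑ j, c j • β j) =
      form (∑ j, c j • simpleRoot (τ j)) (∑ j, c j • simpleRoot (τ j)) := by
  simp only [map_sum, map_smul, LinearMap.sum_apply, LinearMap.smul_apply, hβ.gram,
    form_simpleRoot]

theorem sum_simpleRoot_apply (hβ : IsRootSystemBasis τ β) (c : ι → ℤ) (k : ι) :
    (∑ j, c j • simpleRoot (τ j)) (τ k) = c k := by
  classical
  simp [Finset.sum_apply, simpleRoot, Pi.single_apply, hβ.injective.eq_iff]

theorem form_sum_neg (hβ : IsRootSystemBasis τ β) {c : ι → ℤ} (hc : c ≠ 0) :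
    form (∑ j, c j • β j) (∑ j, c j • β j) < 0 := by
  rw [hβ.form_sum]
  refine form_self_neg (i := 1) one_ne_zero ?_ fun h => hc (funext fun k => ?_)
  · simp [Finset.sum_apply, simpleRoot, fun j => (hβ.ne_one j).symm]
  · rw [← hβ.sum_simpleRoot_apply c k, h, Pi.zero_apply, Pi.zero_apply]

theorem form_self_nonpos_of_mem (hβ : IsRootSystemBasis τ β) {s : Fin 10 → ℤ}
    (hs : s ∈ Submodule.span ℤ (Set.range β)) : form s s ≤ 0 := by
  obtain ⟨c, rfl⟩ := Submodule.mem_span_range_iff_exists_fun ℤ |>.1 hs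
  by_cases hc : c = 0
  · simp [hc]
  · exact (hβ.form_sum_neg hc).le

theorem exists_dual (hβ : IsRootSystemBasis τ β) :
    ∃ d : ℤ, 0 < d ∧ ∀ c : ι → ℤ, ∃ s ∈ Submodule.span ℤ (Set.range β),
      ∀ j, form s (β j) = d * c j := by
  classical
  obtain ⟨A, hA⟩ : ∃ A : Matrix ι ι ℤ, A = Matrix.of fun j k => form (β j) (β k) := ⟨_, rfl⟩
  have hdet : A.det ≠ 0 := fun h => by
    obtain ⟨c, hc, hAc⟩ := Matrix.exists_mulVec_eq_zero_iff.2 h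
    refine (hβ.form_sum_neg hc).ne ?_
    have : ∀ j, form (β j) (∑ k, c k • β k) = 0 := fun j => by
      have := congrFun hAc j
      simp only [hA, Matrix.mulVec, dotProduct, Matrix.of_apply, Pi.zero_apply] at this
      simpa only [map_sum, map_smul, smul_eq_mul, mul_comm] using this
    obtain ⟨y, hy⟩ : ∃ y, y = ∑ k, c k • β k := ⟨_, rfl⟩
    rw [← hy] at this ⊢
    nth_rewrite 1 [hy]
    simp only [map_sum, LinearMap.sum_apply, map_smul, LinearMap.smul_apply, this, smul_zero,
      Finset.sum_const_zero]
  refine ⟨A.det ^ 2, by positivity, fun c => ?_⟩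
  refine ⟨∑ k, (A.det • (c ᵥ* A.adjugate)) k • β k,
    Submodule.sum_mem _ fun k _ => Submodule.smul_mem _ _ (Submodule.subset_span ⟨k, rfl⟩),
    fun j => ?_⟩
  have h1 : ((A.det • (c ᵥ* A.adjugate)) ᵥ* A) j = A.det ^ 2 * c j := by
    rw [Matrix.smul_vecMul, Matrix.vecMul_vecMul, Matrix.adjugate_mul, Matrix.vecMul_smul,
      Matrix.vecMul_one]
    simp only [Pi.smul_apply, smul_eq_mul]
    ring
  rw [← h1, Matrix.vecMul, dotProduct]
  simp only [map_sum, map_smul, LinearMap.sum_apply, LinearMap.smul_apply, smul_eq_mul, hA,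
    Matrix.of_apply]

/-- A primitive negative definite sublattice is its own double orthogonal complement. -/
theorem mem_span (hβ : IsRootSystemBasis τ β) {γ : Fin 10 → ℤ}
    (hγ : ∀ u, (∀ j, form u (β j) = 0) → form u γ = 0) :
    γ ∈ Submodule.span ℤ (Set.range β) := by
  obtain ⟨d, hd, hdual⟩ := hβ.exists_dual
  obtain ⟨t, ht, hγt⟩ := hdual fun j => form γ (β j)
  refine hβ.primitive d γ hd.ne' ?_
  suffices d • γ - t = 0 by rwa [sub_eq_zero.1 this]
  have hperp : ∀ j, form (d • γ - t) (β j) = 0 := fun j => by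
    simp only [map_sub, map_smul, LinearMap.sub_apply, LinearMap.smul_apply, smul_eq_mul, hγt,
      sub_self]
  refine eq_zero_of_form_eq_zero fun i => ?_
  obtain ⟨s, hs, hxs⟩ := hdual fun j => form (simpleRoot i) (β j)
  have hx : ∀ j, form (d • simpleRoot i - s) (β j) = 0 := fun j => by
    simp only [map_sub, map_smul, LinearMap.sub_apply, LinearMap.smul_apply, smul_eq_mul, hxs,
      sub_self]
  have h1 : form (d • simpleRoot i - s) (d • γ - t) = 0 := by
    rw [map_sub, map_smul, hγ _ hx, form_eq_zero_of_mem hx ht, smul_zero, sub_zero]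
  rw [form_comm, map_sub, form_eq_zero_of_mem hperp hs, sub_zero, map_smul, smul_eq_mul] at h1
  exact (mul_eq_zero.1 h1).resolve_left hd.ne'

theorem exists_isPositive (hβ : IsRootSystemBasis τ β) :
    ∃ v, IsPositive v ∧ ∀ j, form v (β j) = 0 := by
  obtain ⟨p, hp⟩ : ∃ p : Fin 10 → ℤ, 0 < form p p :=
    ⟨![30, 61, 93, 126, 160, 195, 231, 153, 76, 115], by simp [form_apply]⟩
  obtain ⟨d, hd, hdual⟩ := hβ.exists_dual
  obtain ⟨s, hs, hps⟩ := hdual fun j => form p (β j)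
  have hv : ∀ j, form (d • p - s) (β j) = 0 := fun j => by
    simp only [map_sub, map_smul, LinearMap.sub_apply, LinearMap.smul_apply, smul_eq_mul, hps,
      sub_self]
  have hvs := form_eq_zero_of_mem hv hs
  have hss := hβ.form_self_nonpos_of_mem hs
  have hvv : 0 < form (d • p - s) (d • p - s) := by
    have : form (d • p) (d • p) = d ^ 2 * form p p := by
      simp only [map_smul, LinearMap.smul_apply, smul_eq_mul]; ring
    have : 0 < form (d • p) (d • p) := by rw [this]; positivity
    simp only [map_sub, LinearMap.sub_apply, form_comm s (d • p)] at hvs ⊢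
    linarith
  generalize d • p - s = v at hv hvv
  rcases lt_trichotomy (v 0) 0 with h | h | h
  · exact ⟨-v, ⟨by simpa using hvv, by simpa using h⟩, fun j => by simpa using hv j⟩
  · exact absurd (form_self_nonpos h) hvv.not_ge
  · exact ⟨_, ⟨hvv, h⟩, hv⟩

/-- If a wall of the chamber contains `v` but not the orthogonal complement of `β`, then `v` can be
moved off this wall. -/
theorem exists_isPositive_ssubset (hβ : IsRootSystemBasis τ β) {v : Fin 10 → ℤ}
    (hv : IsPositive v) (hvβ : ∀ j, form v (β j) = 0) (hvα : ∀ i, 0 ≤ form v (simpleRoot i))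
    {i : Fin 10} (hi : form v (simpleRoot i) = 0)
    (hspan : simpleRoot i ∉ Submodule.span ℤ (Set.range β)) :
    ∃ g ∈ isometryGroup form, ∃ v', IsPositive v' ∧ (∀ j, form v' (g (β j)) = 0) ∧
      (∀ i, 0 ≤ form v' (simpleRoot i)) ∧
      Finset.univ.filter (fun i => form v' (simpleRoot i) = 0) ⊂
        Finset.univ.filter fun i => form v (simpleRoot i) = 0 := by
  obtain ⟨u, huβ, hui⟩ : ∃ u, (∀ j, form u (β j) = 0) ∧ form u (simpleRoot i) ≠ 0 := by
    by_contra! h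
    exact hspan (hβ.mem_span h)
  obtain ⟨m, hm⟩ := hv.exists_add u
  obtain ⟨g, hg, hgpos, hfix, hJ⟩ := (hm m le_rfl).exists_isometry_nonneg
    (Finset.univ.filter fun i => form v (simpleRoot i) = 0)
  simp only [Finset.mem_filter, Finset.mem_univ, true_and] at hfix hJ
  have hgv : g v = v := hfix v fun j hj => hj
  obtain ⟨w, hw⟩ : ∃ w, w = u + m • v := ⟨_, rfl⟩
  rw [← hw] at hgpos hJ
  have hwβ : ∀ j, form w (β j) = 0 := fun j => by
    rw [hw, map_add, map_smul, LinearMap.add_apply, LinearMap.smul_apply, huβ, hvβ, smul_zero,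
      add_zero]
  obtain ⟨N, hN⟩ := hv.exists_add (g w)
  obtain ⟨K, hK⟩ : ∃ K : ℤ, K = ∑ i, |form (g w) (simpleRoot i)| + 1 := ⟨_, rfl⟩
  have hlt : ∀ i, -form (g w) (simpleRoot i) < K := fun i => by
    have := Finset.single_le_sum (f := fun i => |form (g w) (simpleRoot i)|)
      (fun _ _ => abs_nonneg _) (Finset.mem_univ i)
    have := neg_le_abs (form (g w) (simpleRoot i))
    rw [hK]
    beta_reduce at *
    omega
  have hK0 : 0 < K := by
    have := Finset.sum_nonneg fun i (_ : i ∈ Finset.univ) =>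
      abs_nonneg (form (g w) (simpleRoot i))
    omega
  have hadd : ∀ y, form (g w + max N K • v) y = form (g w) y + max N K * form v y := fun y => by
    rw [map_add, map_smul, LinearMap.add_apply, LinearMap.smul_apply, smul_eq_mul]
  have hpos : ∀ i, form v (simpleRoot i) ≠ 0 → 0 < form (g w + max N K • v) (simpleRoot i) := by
    intro i hi
    have h1 : 1 ≤ form v (simpleRoot i) := lt_of_le_of_ne (hvα i) hi.symm
    have h2 : K ≤ max N K := le_max_right _ _
    have h3 := hlt i
    rw [hadd]
    nlinarith
  refine ⟨g, hg, g w + max N K • v, hN _ (le_max_left _ _), fun j => ?_, fun i => ?_, ?_⟩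
  · rw [hadd, hg, hwβ]
    nth_rewrite 1 [← hgv]
    rw [hg, hvβ, mul_zero, add_zero]
  · by_cases hi : form v (simpleRoot i) = 0
    · rw [hadd, hi, mul_zero, add_zero]
      exact hJ i hi
    · exact (hpos i hi).le
  · rw [Finset.ssubset_iff_subset_ne]
    refine ⟨fun i hi => ?_, fun heq => hui ?_⟩
    · simp only [Finset.mem_filter, Finset.mem_univ, true_and] at hi ⊢
      by_contra h
      exact (hpos i h).ne' hi
    · have hzero : ∀ j, form v (simpleRoot j) = 0 → form (g w) (simpleRoot j) = 0 := by
        intro j hj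
        have : j ∈ Finset.univ.filter fun i => form v (simpleRoot i) = 0 := by simpa using hj
        rw [← heq, Finset.mem_filter, hadd, hj, mul_zero, add_zero] at this
        exact this.2
      have hgw : g w = w := g.injective (hfix (g w) hzero)
      have := hzero i hi
      rwa [hgw, hw, map_add, map_smul, LinearMap.add_apply, LinearMap.smul_apply, hi, smul_zero,
        add_zero] at this

/-- The orthogonal complement of `β` can be moved so that it contains a vector of the positive
chamber lying only on those walls which contain the whole orthogonal complement. -/
theorem exists_chamber (hβ : IsRootSystemBasis τ β) :
    ∃ g ∈ isometryGroup form, ∃ v, IsPositive v ∧ (∀ j, form v (g (β j)) = 0) ∧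
      (∀ i, 0 ≤ form v (simpleRoot i)) ∧ ∀ i, form v (simpleRoot i) = 0 →
        simpleRoot i ∈ Submodule.span ℤ (Set.range (g ∘ β)) := by
  obtain ⟨v₀, hv₀, hv₀β⟩ := hβ.exists_isPositive
  obtain ⟨g₀, hg₀, hpos, -, hJ⟩ := hv₀.exists_isometry_nonneg Finset.univ
  suffices h : ∀ n : ℕ, ∀ β : ι → Fin 10 → ℤ, IsRootSystemBasis τ β → ∀ v, IsPositive v →
      (∀ j, form v (β j) = 0) → (∀ i, 0 ≤ form v (simpleRoot i)) →
      (Finset.univ.filter fun i => form v (simpleRoot i) = 0).card = n →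
      ∃ g ∈ isometryGroup form, ∃ v, IsPositive v ∧ (∀ j, form v (g (β j)) = 0) ∧
      (∀ i, 0 ≤ form v (simpleRoot i)) ∧ ∀ i, form v (simpleRoot i) = 0 →
        simpleRoot i ∈ Submodule.span ℤ (Set.range (g ∘ β)) by
    obtain ⟨g, hg, v, hv⟩ := h _ _ (hβ.map hg₀) (g₀ v₀) hpos
      (fun j => (hg₀ _ _).trans (hv₀β j)) (fun i => hJ i (Finset.mem_univ i)) rfl
    exact ⟨g * g₀, mul_mem hg hg₀, v, hv⟩
  intro n
  induction n using Nat.strong_induction_on with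
  | _ n ih =>
    intro β hβ v hv hvβ hvα hn
    by_cases h : ∀ i, form v (simpleRoot i) = 0 → simpleRoot i ∈ Submodule.span ℤ (Set.range β)
    · exact ⟨1, one_mem _, v, hv, hvβ, hvα, h⟩
    push Not at h
    obtain ⟨i, hi, hspan⟩ := h
    obtain ⟨g₁, hg₁, v₁, hv₁, hv₁β, hv₁α, hlt⟩ :=
      hβ.exists_isPositive_ssubset hv hvβ hvα hi hspan
    obtain ⟨g, hg, v, hv⟩ := ih _ (hn ▸ Finset.card_lt_card hlt) _ (hβ.map hg₁) v₁ hv₁ hv₁β hv₁α rfl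
    exact ⟨g * g₁, mul_mem hg hg₁, v, hv⟩

/-- Every primitive root sublattice is conjugate to one generated by simple roots. -/
theorem exists_simpleRoot (hβ : IsRootSystemBasis τ β) :
    ∃ g ∈ isometryGroup form, ∃ σ : ι → Fin 10, ∀ j, g (β j) = simpleRoot (σ j) := by
  obtain ⟨g₁, hg₁, v, hv, hvβ, hvα, hspan⟩ := hβ.exists_chamber
  obtain ⟨d, hd, hdual⟩ := (hβ.map hg₁).exists_dual
  obtain ⟨w, hw, hwβ⟩ := hdual fun _ => 1
  obtain ⟨m, hm⟩ := hv.exists_add w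
  obtain ⟨g₂, hg₂, -, hfix, hJ⟩ := (hm m le_rfl).exists_isometry_nonneg
    (Finset.univ.filter fun i => form v (simpleRoot i) = 0)
  simp only [Finset.mem_filter, Finset.mem_univ, true_and] at hfix hJ
  have hg₂v : g₂ v = v := hfix v fun j hj => hj
  obtain ⟨g, hgdef⟩ : ∃ g, g = g₂ * g₁ := ⟨_, rfl⟩
  have hg : g ∈ isometryGroup form := hgdef ▸ mul_mem hg₂ hg₁
  have hgβ := hβ.map hg
  have hvg : ∀ j, form v (g (β j)) = 0 := fun j => by
    rw [hgdef, LinearEquiv.mul_apply, ← hg₂v, hg₂, hvβ]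
  have hwg : ∀ j, form (g₂ w) (g (β j)) = d := fun j => by
    have := hwβ j
    rw [hgdef, LinearEquiv.mul_apply, hg₂, ← mul_one d, ← this]; rfl
  have hwα : ∀ i, form v (simpleRoot i) = 0 → 0 ≤ form (g₂ w) (simpleRoot i) := fun i hi => by
    have := hJ i hi
    rwa [map_add, map_smul, hg₂v, map_add, map_smul, LinearMap.add_apply, LinearMap.smul_apply, hi,
      smul_zero, add_zero] at this
  have hmem : ∀ i, form v (simpleRoot i) = 0 →
      simpleRoot i ∈ Submodule.span ℤ (Set.range (g ∘ β)) := fun i hi => by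
    refine hgβ.mem_span fun u hu => ?_
    have h1 : ∀ j, form (g₂.symm u) ((g₁ ∘ β) j) = 0 := fun j => by
      rw [← hu j, hgdef, ← hg₂, LinearEquiv.apply_symm_apply]; rfl
    have h2 := hfix (g₂.symm u) fun i hi => form_eq_zero_of_mem h1 (hspan i hi)
    rw [LinearEquiv.apply_symm_apply] at h2
    rw [h2]
    exact form_eq_zero_of_mem h1 (hspan i hi)
  have hge : ∀ i, form v (simpleRoot i) = 0 → d ≤ form (g₂ w) (simpleRoot i) := fun i hi => by
    obtain ⟨c, hc⟩ := Submodule.mem_span_range_iff_exists_fun ℤ |>.1 (hmem i hi)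
    have hroot : form (∑ j, c j • simpleRoot (τ j)) (∑ j, c j • simpleRoot (τ j)) = -2 := by
      rw [← hgβ.form_sum, hc, form_simpleRoot_self]
    have hsum : form (g₂ w) (simpleRoot i) = d * ∑ j, c j := by
      rw [← hc]
      simp only [map_sum, map_smul, Function.comp_apply, hwg, smul_eq_mul, Finset.mul_sum, mul_comm]
    have hc0 : ∑ j, c j = 0 → False := fun h => by
      have : ∀ j, c j = 0 := fun j => by
        rcases root_nonneg_or_nonpos hroot with hs | hs
        · exact (Finset.sum_eq_zero_iff_of_nonneg fun j _ =>
            hgβ.sum_simpleRoot_apply c j ▸ hs (τ j)).1 h j (Finset.mem_univ j)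
        · exact (Finset.sum_eq_zero_iff_of_nonpos fun j _ =>
            hgβ.sum_simpleRoot_apply c j ▸ hs (τ j)).1 h j (Finset.mem_univ j)
      simp [this] at hroot
    have h0 := hwα i hi
    rw [hsum] at h0 ⊢
    have h1 : 0 ≤ ∑ j, c j := nonneg_of_mul_nonneg_right h0 hd
    have h2 : 1 ≤ ∑ j, c j := lt_of_le_of_ne h1 fun h => hc0 h.symm
    nlinarith
  have hsimple : ∀ j, ∃ i, g (β j) = simpleRoot i := fun j => by
    obtain ⟨x, hx⟩ : ∃ x, x = g (β j) := ⟨_, rfl⟩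
    have hroot : form x x = -2 := by
      have : ∀ i, cartan i i = -2 := by decide
      exact hx ▸ (hgβ.gram j j).trans (this _)
    have hvx : ∑ i, x i * form v (simpleRoot i) = 0 := by rw [← form_eq_sum, hx, hvg]
    have hwx : ∑ i, x i * form (g₂ w) (simpleRoot i) = d := by rw [← form_eq_sum, hx, hwg]
    have hsupp : ∀ i, x i ≠ 0 → form v (simpleRoot i) = 0 := fun i hi => by
      refine (mul_eq_zero.1 ?_).resolve_left hi
      rcases root_nonneg_or_nonpos hroot with hs | hs
      · exact (Finset.sum_eq_zero_iff_of_nonneg fun i _ => mul_nonneg (hs i) (hvα i)).1 hvx i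
          (Finset.mem_univ i)
      · exact (Finset.sum_eq_zero_iff_of_nonpos fun i _ =>
          mul_nonpos_of_nonpos_of_nonneg (hs i) (hvα i)).1 hvx i (Finset.mem_univ i)
    have hnonneg : ∀ i, 0 ≤ x i := by
      refine (root_nonneg_or_nonpos hroot).resolve_right fun hs => hd.not_ge ?_
      rw [← hwx]
      refine Finset.sum_nonpos fun i _ => ?_
      by_cases hi : x i = 0
      · rw [hi, zero_mul]
      · exact mul_nonpos_of_nonpos_of_nonneg (hs i) (hwα i (hsupp i hi))
    have hle : (∑ i, x i) * d ≤ 1 * d := by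
      rw [one_mul, Finset.sum_mul]
      nth_rewrite 2 [← hwx]
      refine Finset.sum_le_sum fun i _ => ?_
      by_cases hi : x i = 0
      · rw [hi, zero_mul, zero_mul]
      · exact mul_le_mul_of_nonneg_left (hge i (hsupp i hi)) (hnonneg i)
    have hsum := le_of_mul_le_mul_right hle hd
    obtain ⟨i, hi⟩ : ∃ i, x i ≠ 0 := by
      by_contra! h
      simp [h] at hwx
      omega
    have h1 : 1 ≤ x i := lt_of_le_of_ne (hnonneg i) hi.symm
    refine ⟨i, hx ▸ funext fun k => ?_⟩
    rw [← Finset.add_sum_erase _ _ (Finset.mem_univ i)] at hsum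
    by_cases hk : k = i
    · subst hk
      have := Finset.sum_nonneg fun l (_ : l ∈ Finset.univ.erase k) => hnonneg l
      simp only [simpleRoot, Pi.single_eq_same]
      omega
    · have := Finset.single_le_sum (fun l _ => hnonneg l)
        (Finset.mem_erase.2 ⟨hk, Finset.mem_univ k⟩)
      have := hnonneg k
      simp only [simpleRoot, Pi.single_eq_of_ne hk]
      omega
  choose σ hσ using hsimple
  exact ⟨g, hg, σ, hσ⟩

end IsRootSystemBasis

/-- Two tuples of simple roots are conjugate under the isometry group. -/
def Conjugate (l l' : List (Fin 10)) : Prop :=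
  ∃ g ∈ isometryGroup form, l.map (g ∘ simpleRoot) = l'.map simpleRoot

theorem Conjugate.refl (l : List (Fin 10)) : Conjugate l l := ⟨1, one_mem _, rfl⟩

theorem Conjugate.trans {l₁ l₂ l₃ : List (Fin 10)} (h₁ : Conjugate l₁ l₂) (h₂ : Conjugate l₂ l₃) :
    Conjugate l₁ l₃ := by
  obtain ⟨g, hg, h₁⟩ := h₁
  obtain ⟨g', hg', h₂⟩ := h₂
  refine ⟨g' * g, mul_mem hg' hg, ?_⟩
  rw [← h₂, ← List.map_map (g := g'), ← h₁, List.map_map]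
  rfl

theorem Conjugate.symm {l₁ l₂ : List (Fin 10)} (h : Conjugate l₁ l₂) : Conjugate l₂ l₁ := by
  obtain ⟨g, hg, h⟩ := h
  refine ⟨g⁻¹, inv_mem hg, ?_⟩
  rw [← List.map_map, ← h, List.map_map]
  refine List.map_congr_left fun i _ => ?_
  exact g.symm_apply_apply _

/-- Exchange the nodes `a` and `b` if `a` precedes `b` and all nodes belong to `D`. -/
def exchange (a b : Fin 10) (D : Fin 10 → Bool) (l : List (Fin 10)) : List (Fin 10) :=
  if l.idxOf a < l.idxOf b ∧ l.all D then l.map (Equiv.swap a b) else l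

theorem conjugate_exchange {a b : Fin 10} {D : Fin 10 → Bool}
    (h : ∃ g ∈ isometryGroup form, ∀ c, D c → g (simpleRoot c) = simpleRoot (Equiv.swap a b c))
    (l : List (Fin 10)) : Conjugate l (exchange a b D l) := by
  rw [exchange]
  split_ifs with hl
  · obtain ⟨g, hg, h⟩ := h
    refine ⟨g, hg, ?_⟩
    rw [List.map_map]
    exact List.map_congr_left fun c hc => h c (List.all_eq_true.1 hl.2 c hc)
  · exact Conjugate.refl l

/-- The adjacency relation of the `E₁₀` diagram. -/
def adjacent (i j : Fin 10) : Bool :=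
  i.val + 1 = j.val ∧ j ≠ 9 ∨ j.val + 1 = i.val ∧ i ≠ 9 ∨ i = 6 ∧ j = 9 ∨ i = 9 ∧ j = 6

theorem cartan_eq (i j : Fin 10) :
    cartan i j = if i = j then -2 else if adjacent i j then 1 else 0 := by
  have : ∀ p : Fin 10 × Fin 10,
      cartan p.1 p.2 = if p.1 = p.2 then -2 else if adjacent p.1 p.2 then 1 else 0 := by
    decide +kernel
  exact this (i, j)

/-- The nodes different from and not adjacent to `a` and `b`, together with `a`. -/
def slideDomain (a b c : Fin 10) : Bool :=
  c = a ∨ a ≠ c ∧ adjacent a c = false ∧ b ≠ c ∧ adjacent b c = false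

theorem exists_slide {a b : Fin 10} (hab : cartan a b = 1) :
    ∃ g ∈ isometryGroup form, ∀ c, slideDomain a b c →
      g (simpleRoot c) = simpleRoot (Equiv.swap a b c) := by
  have hba : cartan b a = 1 := by
    rw [← form_simpleRoot, form_comm, form_simpleRoot, hab]
  have hself : ∀ i, cartan i i = -2 := by decide
  refine ⟨_, mul_mem (reflection_mem (simpleRoot a) (form_simpleRoot_self a))
    (reflection_mem (simpleRoot b) (form_simpleRoot_self b)), fun c hc => ?_⟩
  simp only [slideDomain, decide_eq_true_eq] at hc
  simp only [LinearEquiv.mul_apply, reflection_apply, map_add, map_smul, form_simpleRoot]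
  rcases hc with rfl | ⟨h1, h2, h3, h4⟩
  · rw [Equiv.swap_apply_left, hba, hab, hself]
    module
  · rw [Equiv.swap_apply_of_ne_of_ne h1.symm h3.symm]
    simp [cartan_eq, h1, h2, h3, h4]

theorem exists_exchange {a b : Fin 10} {D : Fin 10 → Bool} (δ : Fin 10 → ℤ)
    (hδ : form δ δ = -2) (hab : cartan a b = 0) (ha : form δ (simpleRoot a) = 1)
    (hb : form δ (simpleRoot b) = 1)
    (hD : ∀ c, D c → c = a ∨ c = b ∨ (cartan a c = - form δ (simpleRoot c) ∧
      cartan b c = - form δ (simpleRoot c))) :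
    ∃ g ∈ isometryGroup form, ∀ c, D c → g (simpleRoot c) = simpleRoot (Equiv.swap a b c) := by
  have hba : cartan b a = 0 := by
    rw [← form_simpleRoot, form_comm, form_simpleRoot, hab]
  have hself : ∀ i, cartan i i = -2 := by decide
  have hroot : ∀ i, form δ (simpleRoot i) = 1 →
      form (simpleRoot i + δ) (simpleRoot i + δ) = -2 := fun i hi => by
    simp only [map_add, LinearMap.add_apply, hδ, hi, form_comm _ δ, form_simpleRoot_self]
    norm_num
  refine ⟨_, mul_mem (reflection_mem _ (hroot a ha)) (reflection_mem _ (hroot b hb)),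
    fun c hc => ?_⟩
  simp only [LinearEquiv.mul_apply, reflection_apply, map_add, map_smul, form_simpleRoot,
    LinearMap.add_apply, hδ, form_comm _ δ]
  rcases hD c hc with rfl | rfl | ⟨h1, h2⟩
  · rw [Equiv.swap_apply_left, hba, hab, hself, ha, hb]
    module
  · rw [Equiv.swap_apply_right, hab, hself, ha, hb]
    module
  · rw [Equiv.swap_apply_of_ne_of_ne, h1, h2]
    · simp
    · rintro rfl
      simp [hself, ha] at h1
    · rintro rfl
      simp [hself, hb] at h2

/-- Slide a node along a path. -/
def slides (p : List (Fin 10 × Fin 10)) (l : List (Fin 10)) : List (Fin 10) :=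
  p.foldl (fun l e => exchange e.1 e.2 (slideDomain e.1 e.2) l) l

theorem conjugate_slides (p : List (Fin 10 × Fin 10)) (hp : ∀ e ∈ p, cartan e.1 e.2 = 1)
    (l : List (Fin 10)) : Conjugate l (slides p l) := by
  induction p generalizing l with
  | nil => exact Conjugate.refl l
  | cons e p ih =>
    exact (conjugate_exchange (exists_slide (hp e (by simp))) l).trans
      (ih (fun e he => hp e (by simp [he])) _)

/-- Slide towards node `0`. -/
def slidesDown : List (Fin 10 × Fin 10) := [(6, 5), (5, 4), (4, 3), (3, 2), (2, 1), (1, 0)]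

/-- Move pairwise orthogonal nodes to an initial segment of `0, 2, 4, 6`. -/
def slidesA : List (Fin 10 × Fin 10) :=
  slidesDown ++ slidesDown ++ slidesDown ++ [(7, 8), (9, 6)] ++ slidesDown ++ [(8, 7), (7, 6)] ++
    slidesDown

/-- Sort the nodes `0, 2, 4, 6`. -/
def sortA (l : List (Fin 10)) : List (Fin 10) :=
  let s := exchange 2 0 (· ∈ [0, 2, 4, 6])
  let t := exchange 4 2 (· ∈ [0, 2, 4, 6])
  let u := exchange 6 4 (· ∈ [0, 2, 4, 6])
  s (t (s (u (t (s l)))))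

/-- Sort the end nodes of a subdiagram of type `D`, and move an additional orthogonal node
to `0`. -/
def normalizeD (l : List (Fin 10)) : List (Fin 10) :=
  let l := exchange 9 7 (· ∈ [3, 4, 5, 6, 7, 9]) (slides [(3, 2), (2, 1), (1, 0)] l)
  let l := exchange 9 5 (· ∈ [0, 5, 6, 7, 9]) (exchange 9 7 (· ∈ [0, 5, 6, 7, 9]) l)
  exchange 5 9 (· ∈ [0, 5, 6, 7, 9]) (exchange 7 9 (· ∈ [0, 5, 6, 7, 9]) l)

theorem conjugate_sortA (l : List (Fin 10)) : Conjugate l (sortA l) := by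
  have hs : ∀ l, Conjugate l (exchange 2 0 (· ∈ [0, 2, 4, 6]) l) := conjugate_exchange <|
    exists_exchange (simpleRoot 1) (form_simpleRoot_self 1) rfl (form_simpleRoot _ _)
      (form_simpleRoot _ _) (by simp only [form_simpleRoot]; decide)
  have ht : ∀ l, Conjugate l (exchange 4 2 (· ∈ [0, 2, 4, 6]) l) := conjugate_exchange <|
    exists_exchange (simpleRoot 3) (form_simpleRoot_self 3) rfl (form_simpleRoot _ _)
      (form_simpleRoot _ _) (by simp only [form_simpleRoot]; decide)
  have hu : ∀ l, Conjugate l (exchange 6 4 (· ∈ [0, 2, 4, 6]) l) := conjugate_exchange <|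
    exists_exchange (simpleRoot 5) (form_simpleRoot_self 5) rfl (form_simpleRoot _ _)
      (form_simpleRoot _ _) (by simp only [form_simpleRoot]; decide)
  exact (hs _).trans <| (ht _).trans <| (hu _).trans <| (hs _).trans <| (ht _).trans (hs _)

theorem conjugate_normalizeD (l : List (Fin 10)) : Conjugate l (normalizeD l) := by
  have h97 : ∃ g ∈ isometryGroup form, ∀ c : Fin 10, decide (c ∈ [0, 5, 6, 7, 9]) = true →
      g (simpleRoot c) = simpleRoot (Equiv.swap 9 7 c) :=
    exists_exchange ![0, 0, 0, 0, 1, 1, 1, 0, 0, 0] (by simp [form_apply]) rfl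
      (by simp [form_apply, simpleRoot]) (by simp [form_apply, simpleRoot])
      (by simp [form_apply, simpleRoot, cartan])
  have h95 : ∃ g ∈ isometryGroup form, ∀ c : Fin 10, decide (c ∈ [0, 5, 6, 7, 9]) = true →
      g (simpleRoot c) = simpleRoot (Equiv.swap 9 5 c) :=
    exists_exchange ![0, 0, 0, 0, 0, 0, 1, 1, 1, 0] (by simp [form_apply]) rfl
      (by simp [form_apply, simpleRoot]) (by simp [form_apply, simpleRoot])
      (by simp [form_apply, simpleRoot, cartan])
  have h97' : ∃ g ∈ isometryGroup form, ∀ c : Fin 10, decide (c ∈ [3, 4, 5, 6, 7, 9]) = true →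
      g (simpleRoot c) = simpleRoot (Equiv.swap 9 7 c) :=
    exists_exchange ![0, 0, 1, 1, 1, 1, 1, 0, 0, 0] (by simp [form_apply]) rfl
      (by simp [form_apply, simpleRoot]) (by simp [form_apply, simpleRoot])
      (by simp [form_apply, simpleRoot, cartan])
  refine (conjugate_slides [(3, 2), (2, 1), (1, 0)] (by decide) l).trans ?_
  refine (conjugate_exchange h97' _).trans <| (conjugate_exchange h97 _).trans <|
    (conjugate_exchange h95 _).trans <| (conjugate_exchange ?_ _).trans (conjugate_exchange ?_ _)
  · rwa [Equiv.swap_comm]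
  · rwa [Equiv.swap_comm]

/-- The entries of the column `j` of the Gram matrix in the rows `l`. -/
def links (l : List (Fin 10)) (j : Fin 10) : List ℤ :=
  l.map fun i => if i = j then -2 else if adjacent i j then 1 else 0

theorem sortA_slidesA_one : ∀ a, sortA (slides slidesA [a]) = [0] := by
  decide +kernel

theorem sortA_slidesA_two : ∀ a b, a < b → links [a] b = [0] →
    sortA (slides slidesA [a, b]) = [0, 2] := by
  decide +kernel

theorem sortA_slidesA_three : ∀ a b, a < b → links [a] b = [0] →
    ∀ c, b < c → links [a, b] c = [0, 0] → sortA (slides slidesA [a, b, c]) = [0, 2, 4] := by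
  decide +kernel

theorem sortA_slidesA_four : ∀ a b, a < b → links [a] b = [0] →
    ∀ c, b < c → links [a, b] c = [0, 0] → ∀ d, c < d → links [a, b, c] d = [0, 0, 0] →
    sortA (slides slidesA [a, b, c, d]) = [0, 2, 4, 6] := by
  decide +kernel

theorem normalizeD_D4 : ∀ a b, links [a] b = [1] → ∀ c, links [a, b] c = [1, 0] →
    ∀ d, links [a, b, c] d = [1, 0, 0] → normalizeD [a, b, c, d] = [6, 9, 5, 7] := by
  decide +kernel

theorem normalizeD_D4A1 : ∀ a b, links [a] b = [1] → ∀ c, links [a, b] c = [1, 0] →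
    ∀ d, links [a, b, c] d = [1, 0, 0] → ∀ e, links [a, b, c, d] e = [0, 0, 0, 0] →
    normalizeD [a, b, c, d, e] = [6, 9, 5, 7, 0] := by
  decide +kernel

theorem normalizeD_D6 : ∀ a b, links [a] b = [1] → ∀ c, links [a, b] c = [0, 1] →
    ∀ d, links [a, b, c] d = [0, 0, 1] → ∀ e, links [a, b, c, d] e = [0, 0, 0, 1] →
    ∀ f, links [a, b, c, d, e] f = [0, 0, 0, 1, 0] →
    normalizeD [a, b, c, d, e, f] = [3, 4, 5, 6, 7, 9] := by
  decide +kernel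

theorem eq_of_links_E7 : ∀ a b, links [a] b = [1] → ∀ c, links [a, b] c = [0, 1] →
    ∀ d, links [a, b, c] d = [0, 0, 1] → ∀ e, links [a, b, c, d] e = [0, 0, 0, 1] →
    ∀ f, links [a, b, c, d, e] f = [0, 0, 0, 0, 1] →
    ∀ g, links [a, b, c, d, e, f] g = [0, 0, 0, 1, 0, 0] →
    [a, b, c, d, e, f, g] = [3, 4, 5, 6, 7, 8, 9] := by
  decide +kernel

theorem eq_of_links_E8 : ∀ a b, links [a] b = [1] → ∀ c, links [a, b] c = [0, 1] →
    ∀ d, links [a, b, c] d = [0, 0, 1] → ∀ e, links [a, b, c, d] e = [0, 0, 0, 1] →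
    ∀ f, links [a, b, c, d, e] f = [0, 0, 0, 0, 1] →
    ∀ g, links [a, b, c, d, e, f] g = [0, 0, 0, 0, 0, 1] →
    ∀ h, links [a, b, c, d, e, f, g] h = [0, 0, 0, 0, 1, 0, 0] →
    [a, b, c, d, e, f, g, h] = [2, 3, 4, 5, 6, 7, 8, 9] := by
  decide +kernel

theorem links_eq (l : List (Fin 10)) (j : Fin 10) : links l j = l.map fun i => cartan i j := by
  simp only [links, cartan_eq]

theorem conjugate_ofFn {m : ℕ} {σ σ' : Fin m → Fin 10} :
    Conjugate (List.ofFn σ) (List.ofFn σ') ↔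
      ∃ g ∈ isometryGroup form, ∀ j, g (simpleRoot (σ j)) = simpleRoot (σ' j) := by
  simp only [Conjugate, List.map_ofFn, List.ofFn_inj, funext_iff, Function.comp_apply]

/-- The nodes `0, 2, 4, …`. -/
def evenNodes (k : ℕ) (j : Fin k) : Fin 10 := Fin.ofNat 10 (2 * j)

theorem conjugate_evenNodes {k : ℕ}
    (hmono : ∀ σ : Fin k → Fin 10, StrictMono σ → (∀ i j, cartan (σ i) (σ j) = A1pow k i j) →
      Conjugate (List.ofFn σ) (List.ofFn (evenNodes k)))
    (hperm : ∀ π : Equiv.Perm (Fin k),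
      sortA (List.ofFn (evenNodes k ∘ π)) = List.ofFn (evenNodes k))
    {σ : Fin k → Fin 10} (hσ : ∀ i j, cartan (σ i) (σ j) = A1pow k i j) :
    Conjugate (List.ofFn σ) (List.ofFn (evenNodes k)) := by
  have hinj : Function.Injective σ := fun i j hij => by
    by_contra hne
    have h1 := hσ i j
    have h2 := hσ j j
    rw [A1pow, Matrix.diagonal_apply_ne _ hne, hij] at h1
    rw [A1pow, Matrix.diagonal_apply_eq] at h2
    omega
  obtain ⟨π, hπ⟩ : ∃ π, π = Tuple.sort σ := ⟨_, rfl⟩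
  have hsorted : StrictMono (σ ∘ π) :=
    (hπ ▸ Tuple.monotone_sort σ).strictMono_of_injective (hinj.comp π.injective)
  obtain ⟨g, hg, hgσ⟩ := conjugate_ofFn.1 <| hmono (σ ∘ π) hsorted fun i j => by
    rw [Function.comp_apply, Function.comp_apply, hσ, A1pow, Matrix.diagonal_apply,
      Matrix.diagonal_apply]
    simp only [π.injective.eq_iff]
  have h1 : Conjugate (List.ofFn σ) (List.ofFn (evenNodes k ∘ π.symm)) :=
    conjugate_ofFn.2 ⟨g, hg, fun j => by simpa using hgσ (π.symm j)⟩
  have h2 := conjugate_sortA (List.ofFn (evenNodes k ∘ π.symm))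
  rw [hperm] at h2
  exact h1.trans h2

/-- Any two subdiagrams of `E₁₀` of type `G` are conjugate. -/
def IsTransitive {m : ℕ} (G : Matrix (Fin m) (Fin m) ℤ) : Prop :=
  ∃ l, ∀ σ : Fin m → Fin 10, (∀ i j, cartan (σ i) (σ j) = G i j) → Conjugate (List.ofFn σ) l

theorem IsTransitive.exists_isometry {m : ℕ} {G : Matrix (Fin m) (Fin m) ℤ} (hG : IsTransitive G)
    {σ σ' : Fin m → Fin 10} (hσ : ∀ i j, cartan (σ i) (σ j) = G i j)
    (hσ' : ∀ i j, cartan (σ' i) (σ' j) = G i j) :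
    ∃ g ∈ isometryGroup form, ∀ j, g (simpleRoot (σ j)) = simpleRoot (σ' j) := by
  obtain ⟨l, hl⟩ := hG
  exact conjugate_ofFn.1 ((hl σ hσ).trans (hl σ' hσ').symm)

theorem isTransitive_A1pow_zero : IsTransitive (A1pow 0) := ⟨[], fun _ _ => Conjugate.refl _⟩

theorem conjugate_sortA_slidesA (l : List (Fin 10)) : Conjugate l (sortA (slides slidesA l)) :=
  (conjugate_slides slidesA (by decide +kernel) l).trans (conjugate_sortA _)

theorem isTransitive_A1pow_one : IsTransitive (A1pow 1) :=
  ⟨[0], fun σ _ => sortA_slidesA_one (σ 0) ▸ conjugate_sortA_slidesA _⟩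

theorem isTransitive_A1pow_two : IsTransitive (A1pow 2) := by
  refine ⟨_, fun σ => conjugate_evenNodes (fun σ hlt hσ => ?_) (by decide +kernel)⟩
  have h := sortA_slidesA_two (σ 0) (σ 1) (hlt (by decide))
    (by simp only [links_eq, List.map, hσ]; rfl)
  have hconj := conjugate_sortA_slidesA [σ 0, σ 1]
  rwa [h] at hconj

theorem isTransitive_A1pow_three : IsTransitive (A1pow 3) := by
  refine ⟨_, fun σ => conjugate_evenNodes (fun σ hlt hσ => ?_) (by decide +kernel)⟩
  have h := sortA_slidesA_three (σ 0) (σ 1) (hlt (by decide))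
    (by simp only [links_eq, List.map, hσ]; rfl) (σ 2) (hlt (by decide))
    (by simp only [links_eq, List.map, hσ]; rfl)
  have hconj := conjugate_sortA_slidesA [σ 0, σ 1, σ 2]
  rwa [h] at hconj

theorem isTransitive_A1pow_four : IsTransitive (A1pow 4) := by
  refine ⟨_, fun σ => conjugate_evenNodes (fun σ hlt hσ => ?_) (by decide +kernel)⟩
  have h := sortA_slidesA_four (σ 0) (σ 1) (hlt (by decide))
    (by simp only [links_eq, List.map, hσ]; rfl) (σ 2) (hlt (by decide))
    (by simp only [links_eq, List.map, hσ]; rfl) (σ 3) (hlt (by decide))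
    (by simp only [links_eq, List.map, hσ]; rfl)
  have hconj := conjugate_sortA_slidesA [σ 0, σ 1, σ 2, σ 3]
  rwa [h] at hconj

theorem isTransitive_D4G : IsTransitive D4G := by
  refine ⟨[6, 9, 5, 7], fun σ hσ => ?_⟩
  have h := normalizeD_D4 (σ 0) (σ 1) ?_ (σ 2) ?_ (σ 3) ?_
  · have hconj := conjugate_normalizeD [σ 0, σ 1, σ 2, σ 3]
    rwa [h] at hconj
  all_goals simp only [links_eq, List.map, hσ]; rfl

theorem isTransitive_D4A1G : IsTransitive D4A1G := by
  refine ⟨[6, 9, 5, 7, 0], fun σ hσ => ?_⟩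
  have h := normalizeD_D4A1 (σ 0) (σ 1) ?_ (σ 2) ?_ (σ 3) ?_ (σ 4) ?_
  · have hconj := conjugate_normalizeD [σ 0, σ 1, σ 2, σ 3, σ 4]
    rwa [h] at hconj
  all_goals simp only [links_eq, List.map, hσ]; rfl

theorem isTransitive_D6G : IsTransitive D6G := by
  refine ⟨[3, 4, 5, 6, 7, 9], fun σ hσ => ?_⟩
  have h := normalizeD_D6 (σ 0) (σ 1) ?_ (σ 2) ?_ (σ 3) ?_ (σ 4) ?_ (σ 5) ?_
  · have hconj := conjugate_normalizeD [σ 0, σ 1, σ 2, σ 3, σ 4, σ 5]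
    rwa [h] at hconj
  all_goals simp only [links_eq, List.map, hσ]; rfl

theorem isTransitive_E7G : IsTransitive E7G := by
  refine ⟨[3, 4, 5, 6, 7, 8, 9], fun σ hσ => ?_⟩
  have h := eq_of_links_E7 (σ 0) (σ 1) ?_ (σ 2) ?_ (σ 3) ?_ (σ 4) ?_ (σ 5) ?_ (σ 6) ?_
  · rw [show List.ofFn σ = _ from h]
    exact Conjugate.refl _
  all_goals simp only [links_eq, List.map, hσ]; rfl

theorem isTransitive_E8G : IsTransitive E8G := by
  refine ⟨[2, 3, 4, 5, 6, 7, 8, 9], fun σ hσ => ?_⟩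
  have h := eq_of_links_E8 (σ 0) (σ 1) ?_ (σ 2) ?_ (σ 3) ?_ (σ 4) ?_ (σ 5) ?_ (σ 6) ?_ (σ 7) ?_
  · rw [show List.ofFn σ = _ from h]
    exact Conjugate.refl _
  all_goals simp only [links_eq, List.map, hσ]; rfl

/-- The primitive sublattices with Gram matrix `G`, endowed with a basis, are conjugate. -/
def IsUnique {m : ℕ} (G : Matrix (Fin m) (Fin m) ℤ) : Prop :=
  ∀ β β' : Fin m → Fin 10 → ℤ, (∀ i j, form (β i) (β j) = G i j) →
    (∀ i j, form (β' i) (β' j) = G i j) →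
    (∀ (n : ℤ) (x : Fin 10 → ℤ), n ≠ 0 → n • x ∈ Submodule.span ℤ (Set.range β) →
      x ∈ Submodule.span ℤ (Set.range β)) →
    (∀ (n : ℤ) (x : Fin 10 → ℤ), n ≠ 0 → n • x ∈ Submodule.span ℤ (Set.range β') →
      x ∈ Submodule.span ℤ (Set.range β')) →
    ∃ g ∈ isometryGroup form, ∀ j, g (β j) = β' j

theorem IsTransitive.isUnique {m : ℕ} {G : Matrix (Fin m) (Fin m) ℤ} (hG : IsTransitive G)
    (τ : Fin m → Fin 10) (hinj : Function.Injective τ) (hone : ∀ j, τ j ≠ 1)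
    (hτ : ∀ p : Fin m × Fin m, cartan (τ p.1) (τ p.2) = G p.1 p.2) : IsUnique G := by
  intro β β' hβ hβ' hprim hprim'
  obtain ⟨g, hg, σ, hσ⟩ := IsRootSystemBasis.exists_simpleRoot (τ := τ)
    ⟨hinj, hone, fun i j => (hβ i j).trans (hτ (i, j)).symm, hprim⟩
  obtain ⟨g', hg', σ', hσ'⟩ := IsRootSystemBasis.exists_simpleRoot (τ := τ)
    ⟨hinj, hone, fun i j => (hβ' i j).trans (hτ (i, j)).symm, hprim'⟩
  obtain ⟨h, hh, hσσ'⟩ := hG.exists_isometry (σ := σ) (σ' := σ')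
    (fun i j => by rw [← form_simpleRoot, ← hσ, ← hσ, hg, hβ])
    (fun i j => by rw [← form_simpleRoot, ← hσ', ← hσ', hg', hβ'])
  refine ⟨g'⁻¹ * h * g, mul_mem (mul_mem (inv_mem hg') hh) hg, fun j => ?_⟩
  rw [LinearEquiv.mul_apply, LinearEquiv.mul_apply, hσ, hσσ', ← hσ']
  exact g'.symm_apply_apply _

/-- The isometry from `U ⊕ E₈` to the `E₁₀` root lattice. -/
def toE10 : (Fin 2 ⊕ Fin 8 → ℤ) ≃ₗ[ℤ] (Fin 10 → ℤ) where
  toFun y := ![y (.inl 1), y (.inl 0) + y (.inl 1), y (.inr 0) + 2 * (y (.inl 0) + y (.inl 1)),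
    y (.inr 1) + 3 * (y (.inl 0) + y (.inl 1)), y (.inr 2) + 4 * (y (.inl 0) + y (.inl 1)),
    y (.inr 3) + 5 * (y (.inl 0) + y (.inl 1)), y (.inr 4) + 6 * (y (.inl 0) + y (.inl 1)),
    y (.inr 5) + 4 * (y (.inl 0) + y (.inl 1)), y (.inr 6) + 2 * (y (.inl 0) + y (.inl 1)),
    y (.inr 7) + 3 * (y (.inl 0) + y (.inl 1))]
  invFun x := Sum.elim ![x 1 - x 0, x 0] ![x 2 - 2 * x 1, x 3 - 3 * x 1, x 4 - 4 * x 1,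
    x 5 - 5 * x 1, x 6 - 6 * x 1, x 7 - 4 * x 1, x 8 - 2 * x 1, x 9 - 3 * x 1]
  map_add' x y := by ext i; fin_cases i <;> simp <;> ring
  map_smul' c x := by ext i; fin_cases i <;> simp <;> ring
  left_inv y := by ext (i | i) <;> fin_cases i <;> simp
  right_inv x := by ext i; fin_cases i <;> simp

theorem form_toE10 (x y : Fin 2 ⊕ Fin 8 → ℤ) : form (toE10 x) (toE10 y) = B10 x y := by
  rw [form_apply]
  simp [toE10, B10, Gram10, UG, E8G, dotProduct, Matrix.mulVec, Fin.sum_univ_succ]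
  ring

theorem IsUnique.exists_isometry {S : Type} [AddCommGroup S] [Module ℤ S]
    {BS : S →ₗ[ℤ] S →ₗ[ℤ] ℤ} {m : ℕ} {G : Matrix (Fin m) (Fin m) ℤ} (hG : IsUnique G)
    (hS : IsoToGram S BS G) {i i' : S →ₗ[ℤ] (Fin 2 ⊕ Fin 8 → ℤ)}
    (hiform : ∀ x y, B10 (i x) (i y) = BS x y) (hi'form : ∀ x y, B10 (i' x) (i' y) = BS x y)
    (hiprim : ∀ (n : ℤ) (y : (Fin 2 ⊕ Fin 8 → ℤ) ⧸ LinearMap.range i), n ≠ 0 → n • y = 0 → y = 0)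
    (hi'prim : ∀ (n : ℤ) (y : (Fin 2 ⊕ Fin 8 → ℤ) ⧸ LinearMap.range i'),
      n ≠ 0 → n • y = 0 → y = 0) :
    ∃ f : (Fin 2 ⊕ Fin 8 → ℤ) ≃ₗ[ℤ] (Fin 2 ⊕ Fin 8 → ℤ),
      (∀ x y, B10 (f x) (f y) = B10 x y) ∧ ∀ s, f (i s) = i' s := by
  obtain ⟨e, he⟩ := hS
  obtain ⟨b, hb⟩ : ∃ b : Module.Basis (Fin m) ℤ S, b = Module.Basis.ofEquivFun e := ⟨_, rfl⟩
  have hgram : ∀ j k, BS (b j) (b k) = G j k := fun j k => by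
    rw [he, hb]
    simp
  have hspan : ∀ k : S →ₗ[ℤ] (Fin 2 ⊕ Fin 8 → ℤ),
      Submodule.span ℤ (Set.range fun j => toE10 (k (b j))) =
        (LinearMap.range k).map toE10.toLinearMap := fun k => by
    rw [LinearMap.range_eq_map, ← b.span_eq, Submodule.map_span, Submodule.map_span,
      ← Set.range_comp, ← Set.range_comp]
    rfl
  have hprim : ∀ k : S →ₗ[ℤ] (Fin 2 ⊕ Fin 8 → ℤ),
      (∀ (n : ℤ) (y : (Fin 2 ⊕ Fin 8 → ℤ) ⧸ LinearMap.range k), n ≠ 0 → n • y = 0 → y = 0) →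
      ∀ (n : ℤ) (x : Fin 10 → ℤ), n ≠ 0 →
        n • x ∈ Submodule.span ℤ (Set.range fun j => toE10 (k (b j))) →
        x ∈ Submodule.span ℤ (Set.range fun j => toE10 (k (b j))) := by
    intro k hk n x hn hx
    rw [hspan, Submodule.mem_map_equiv] at hx ⊢
    rw [map_smul] at hx
    rw [← Submodule.Quotient.mk_eq_zero] at hx ⊢
    exact hk n _ hn hx
  obtain ⟨g, hg, hgβ⟩ := hG (fun j => toE10 (i (b j))) (fun j => toE10 (i' (b j)))
    (fun j k => by rw [form_toE10, hiform, hgram]) (fun j k => by rw [form_toE10, hi'form, hgram])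
    (hprim i hiprim) (hprim i' hi'prim)
  refine ⟨toE10.trans (g.trans toE10.symm), fun x y => ?_, fun s => ?_⟩
  · simp only [← form_toE10, LinearEquiv.trans_apply, LinearEquiv.apply_symm_apply]
    rw [hg]
  · have h : (toE10.trans (g.trans toE10.symm)).toLinearMap ∘ₗ i = i' := b.ext fun j => by
      simp [hgβ j]
    exact LinearMap.congr_fun h s

theorem isUnique_A1pow_zero : IsUnique (A1pow 0) :=
  isTransitive_A1pow_zero.isUnique ![] (by decide) (by decide) (by decide)

theorem isUnique_A1pow_one : IsUnique (A1pow 1) :=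
  isTransitive_A1pow_one.isUnique ![2] (by decide) (by decide) (by decide +kernel)

theorem isUnique_A1pow_two : IsUnique (A1pow 2) :=
  isTransitive_A1pow_two.isUnique ![2, 4] (by decide) (by decide) (by decide +kernel)

theorem isUnique_A1pow_three : IsUnique (A1pow 3) :=
  isTransitive_A1pow_three.isUnique ![2, 4, 6] (by decide) (by decide) (by decide +kernel)

theorem isUnique_A1pow_four : IsUnique (A1pow 4) :=
  isTransitive_A1pow_four.isUnique ![2, 4, 6, 8] (by decide) (by decide) (by decide +kernel)

theorem isUnique_D4G : IsUnique D4G :=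
  isTransitive_D4G.isUnique ![6, 5, 7, 9] (by decide) (by decide) (by decide +kernel)

theorem isUnique_D4A1G : IsUnique D4A1G :=
  isTransitive_D4A1G.isUnique ![6, 5, 7, 9, 2] (by decide) (by decide) (by decide +kernel)

theorem isUnique_D6G : IsUnique D6G :=
  isTransitive_D6G.isUnique ![3, 4, 5, 6, 7, 9] (by decide) (by decide) (by decide +kernel)

theorem isUnique_E7G : IsUnique E7G :=
  isTransitive_E7G.isUnique ![3, 4, 5, 6, 7, 8, 9] (by decide) (by decide) (by decide +kernel)

theorem isUnique_E8G : IsUnique E8G :=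
  isTransitive_E8G.isUnique ![2, 3, 4, 5, 6, 7, 8, 9] (by decide) (by decide) (by decide +kernel)

end E10

/-- Lemma 5.2: Any two primitive embeddings into `U ⊕ E₈` of a
lattice isometric to one of `0, A₁, A₁², A₁³, A₁⁴, D₄, D₄⊕A₁, D₆, E₇, E₈`
differ by an isometry of `U ⊕ E₈`. -/
theorem stmt_12 (S : Type) [AddCommGroup S] [Module ℤ S]
    (BS : S →ₗ[ℤ] S →ₗ[ℤ] ℤ)
    (hlist : IsoToGram S BS (A1pow 0) ∨ IsoToGram S BS (A1pow 1) ∨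
      IsoToGram S BS (A1pow 2) ∨ IsoToGram S BS (A1pow 3) ∨
      IsoToGram S BS (A1pow 4) ∨ IsoToGram S BS D4G ∨
      IsoToGram S BS D4A1G ∨ IsoToGram S BS D6G ∨
      IsoToGram S BS E7G ∨ IsoToGram S BS E8G)
    (i i' : S →ₗ[ℤ] ((Fin 2 ⊕ Fin 8) → ℤ))
    (hi : Function.Injective i) (hi' : Function.Injective i')
    (hiform : ∀ x y, B10 (i x) (i y) = BS x y)
    (hi'form : ∀ x y, B10 (i' x) (i' y) = BS x y)
    (hiprim : ∀ (n : ℤ) (y : ((Fin 2 ⊕ Fin 8) → ℤ) ⧸ LinearMap.range i),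
      n ≠ 0 → n • y = 0 → y = 0)
    (hi'prim : ∀ (n : ℤ) (y : ((Fin 2 ⊕ Fin 8) → ℤ) ⧸ LinearMap.range i'),
      n ≠ 0 → n • y = 0 → y = 0) :
    ∃ f : ((Fin 2 ⊕ Fin 8) → ℤ) ≃ₗ[ℤ] ((Fin 2 ⊕ Fin 8) → ℤ),
      (∀ x y, B10 (f x) (f y) = B10 x y) ∧ ∀ s, f (i s) = i' s := by
  rcases hlist with h | h | h | h | h | h | h | h | h | h
  · exact E10.isUnique_A1pow_zero.exists_isometry h hiform hi'form hiprim hi'prim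
  · exact E10.isUnique_A1pow_one.exists_isometry h hiform hi'form hiprim hi'prim
  · exact E10.isUnique_A1pow_two.exists_isometry h hiform hi'form hiprim hi'prim
  · exact E10.isUnique_A1pow_three.exists_isometry h hiform hi'form hiprim hi'prim
  · exact E10.isUnique_A1pow_four.exists_isometry h hiform hi'form hiprim hi'prim
  · exact E10.isUnique_D4G.exists_isometry h hiform hi'form hiprim hi'prim
  · exact E10.isUnique_D4A1G.exists_isometry h hiform hi'form hiprim hi'prim
  · exact E10.isUnique_D6G.exists_isometry h hiform hi'form hiprim hi'prim
  · exact E10.isUnique_E7G.exists_isometry h hiform hi'form hiprim hi'prim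
  · exact E10.isUnique_E8G.exists_isometry h hiform hi'form hiprim hi'prim
end
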